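/- arXiv:2303.12607 — 16 statements merged into one kernel-verified Lean document; each statement's English description precedes it below -/
import Mathlib

section
/- Fix integers n ≥ 1 and k ≥ 1. There exist finitely many classes A_1, ..., A_m ∈ U_5^{(k)} such that for every x ∈ P^{c_1>0}, the infimum inf{ ω_x(A) : A ∈ U_5^{(k)} } is attained and equals min{ ω_x(A_1), ..., ω_x(A_m) }. (In other words, the k-th tamed capacity f_k(x) = inf{ ω_x(A) : A ∈ U_5^{(k)} } is a tropical polynomial on the c_1-nef cone.) -/
/-- The index `ind(A) = a^2 + 3a - ∑ (b_i^2 + b_i)` of a class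
`A = aH - ∑ b_i E_i`, encoded as `A : ℕ → ℤ` with `A 0 = a` and `A i = b_i`
for `1 ≤ i ≤ n`. -/
def indCl (n : ℕ) (A : ℕ → ℤ) : ℤ :=
  (A 0) ^ 2 + 3 * A 0 - ∑ i ∈ Finset.Icc 1 n, ((A i) ^ 2 + A i)

/-- The set `U_5^{(k)}` of classes `A = aH - ∑ b_i E_i` with `a > 0` and
`ind(A) ≥ 2k` (classes are supported on coordinates `0, …, n`). -/
def U5 (n k : ℕ) : Set (ℕ → ℤ) :=
  {A | 0 < A 0 ∧ 2 * (k : ℤ) ≤ indCl n A ∧ ∀ i, n < i → A i = 0}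

/-- `ω_x(A) = a x_0 - ∑ b_i x_i`. -/
def omegaEval (n : ℕ) (x : ℕ → ℝ) (A : ℕ → ℤ) : ℝ :=
  (A 0 : ℝ) * x 0 - ∑ i ∈ Finset.Icc 1 n, (A i : ℝ) * x i

/-- The `c_1`-nef cone `P^{c_1>0}` in `ℝ^{n+1}` (coordinates `x 0, …, x n`). -/
def c1Nef (n : ℕ) : Set (ℕ → ℝ) :=
  {x | 0 < 3 * x 0 - ∑ i ∈ Finset.Icc 1 n, x i ∧
    (if n = 1 then 0 < x 1 ∧ x 1 < x 0
     else if n = 2 then 0 < x 2 ∧ x 2 ≤ x 1 ∧ x 1 + x 2 < x 0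
     else 0 < x n ∧ (∀ i j, 1 ≤ i → i ≤ j → j ≤ n → x j ≤ x i) ∧
          x 1 + x 2 + x 3 ≤ x 0 ∧ ∑ i ∈ Finset.Icc 1 n, (x i) ^ 2 < (x 0) ^ 2)}

/-- The first coordinate of the `m`-th generator of the cone of reduced vectors. -/
def genHead (m : ℕ) : ℤ := max 1 (min m 3)

/-- The pairing of `A` with the `m`-th generator `genHead m H - E_1 - ... - E_m` of the cone of
reduced vectors. -/
def genPair (n m : ℕ) (A : ℕ → ℤ) : ℤ :=
  genHead m * A 0 - ∑ i ∈ Finset.Icc 1 n, (if i ≤ m then 1 else 0) * A i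

/-- The first Chern number of the `m`-th generator of the cone of reduced vectors. -/
def genChern (m : ℕ) : ℤ := 3 * genHead m - m

/-- The pairings of `A` with generators of the cone of reduced vectors having nonnegative
first Chern number. -/
def conePair (n : ℕ) (A : ℕ → ℤ) (q : Fin 10 × Fin (n + 1)) : ℤ :=
  if q.2.val = 0 then genPair n q.1 A
  else (q.2.val : ℤ) * genPair n q.1 A + genChern q.1 * genPair n (9 + q.2) A

/-- A class in the closed forward light cone pairs with `U_5^{(k)}` in a way that is bounded
below. -/
lemma U5_pairing_bddBelow (n k : ℕ) (u : ℕ → ℤ) (hu : 0 ≤ u 0)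
    (hsq : ∑ i ∈ Finset.Icc 1 n, u i ^ 2 ≤ u 0 ^ 2) :
    ∃ C : ℤ, ∀ A ∈ U5 n k, 0 ≤ u 0 * A 0 - ∑ i ∈ Finset.Icc 1 n, u i * A i + C := by
  refine ⟨u 0 * (n + 3) + |∑ i ∈ Finset.Icc 1 n, u i|, ?_⟩
  rintro A ⟨hA, hind, -⟩
  unfold indCl at hind
  have hβ : ∑ i ∈ Finset.Icc 1 n, (2 * A i + 1) ^ 2
      = 4 * ∑ i ∈ Finset.Icc 1 n, (A i ^ 2 + A i) + n := by
    have : (n : ℤ) = ∑ i ∈ Finset.Icc 1 n, (1 : ℤ) := by simp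
    rw [this, Finset.mul_sum, ← Finset.sum_add_distrib]
    exact Finset.sum_congr rfl fun i _ => by ring
  have huβ : ∑ i ∈ Finset.Icc 1 n, u i * (2 * A i + 1)
      = 2 * ∑ i ∈ Finset.Icc 1 n, u i * A i + ∑ i ∈ Finset.Icc 1 n, u i := by
    rw [Finset.mul_sum, ← Finset.sum_add_distrib]
    exact Finset.sum_congr rfl fun i _ => by ring
  have hn : (0 : ℤ) ≤ n := by positivity
  have hk : (0 : ℤ) ≤ k := by positivity
  have hCS := Finset.sum_mul_sq_le_sq_mul_sq (Finset.Icc 1 n) u (fun i => 2 * A i + 1)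
  have hle : ∑ i ∈ Finset.Icc 1 n, (2 * A i + 1) ^ 2 ≤ (2 * A 0 + 3 + n) ^ 2 := by
    rw [hβ]; nlinarith
  have hsq' : (∑ i ∈ Finset.Icc 1 n, u i * (2 * A i + 1)) ^ 2
      ≤ (u 0 * (2 * A 0 + 3 + n)) ^ 2 := by
    rw [mul_pow]
    exact hCS.trans (mul_le_mul hsq hle (Finset.sum_nonneg fun i _ => sq_nonneg _)
      (sq_nonneg _))
  have h := abs_le_of_sq_le_sq hsq' (by positivity)
  have h2 := (abs_le.1 h).2
  rw [huβ] at h2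
  have h3 := neg_abs_le (∑ i ∈ Finset.Icc 1 n, u i)
  have h4 : 0 ≤ u 0 * (n + 3) := by positivity
  have h5 := abs_nonneg (∑ i ∈ Finset.Icc 1 n, u i)
  nlinarith

lemma genHead_sq (m : ℕ) (hm : m ≤ 9) : (m : ℤ) ≤ genHead m ^ 2 := by
  interval_cases m <;> decide

lemma genHead_pos (m : ℕ) : 0 < genHead m := by
  unfold genHead; omega

lemma genChern_nonneg (m : ℕ) (hm : m ≤ 9) : 0 ≤ genChern m := by
  interval_cases m <;> decide

lemma genHead_nine_add (j : ℕ) : genHead (9 + j) = 3 := by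
  unfold genHead; omega

lemma sum_ite_le (n m : ℕ) :
    ∑ i ∈ Finset.Icc 1 n, (if i ≤ m then (1 : ℤ) else 0) ≤ m := by
  rw [Finset.sum_boole]
  have : (Finset.Icc 1 n).filter (· ≤ m) ⊆ Finset.Icc 1 m := by
    intro i; simp only [Finset.mem_filter, Finset.mem_Icc]; omega
  simpa using Finset.card_le_card this

lemma conePair_bddBelow (n k : ℕ) (q : Fin 10 × Fin (n + 1)) :
    ∃ C : ℤ, ∀ A ∈ U5 n k, 0 ≤ conePair n A q + C := by
  obtain ⟨⟨m, hm⟩, ⟨j, hj⟩⟩ := q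
  have hm9 : m ≤ 9 := by omega
  by_cases hj0 : j = 0
  · obtain ⟨C, hC⟩ := U5_pairing_bddBelow n k
      (fun i => if i = 0 then genHead m else if i ≤ m then 1 else 0)
      (by simpa using (genHead_pos m).le) (by
        refine le_trans (le_of_eq ?_) ((sum_ite_le n m).trans (by simpa using genHead_sq m hm9))
        refine Finset.sum_congr rfl fun i hi => ?_
        have : i ≠ 0 := by rw [Finset.mem_Icc] at hi; omega
        by_cases him : i ≤ m <;> simp [this, him])
    refine ⟨C, fun A hA => (hC A hA).trans (le_of_eq ?_)⟩
    simp only [conePair, genPair, hj0, if_true]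
    congr 2
    refine Finset.sum_congr rfl fun i hi => ?_
    have : i ≠ 0 := by rw [Finset.mem_Icc] at hi; omega
    simp [this]
  · have hc := genChern_nonneg m hm9
    have hh := genHead_pos m
    have hs := genHead_sq m hm9
    have hj' : (0 : ℤ) ≤ j := by positivity
    obtain ⟨C, hC⟩ := U5_pairing_bddBelow n k
      (fun i => if i = 0 then j * genHead m + genChern m * 3 else
        j * (if i ≤ m then 1 else 0) + genChern m * (if i ≤ 9 + j then 1 else 0))
      (by simp only [if_true]; positivity) (by
        have hterm : ∀ i ∈ Finset.Icc 1 n, (if i = 0 then j * genHead m + genChern m * 3 else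
            j * (if i ≤ m then 1 else 0) + genChern m * (if i ≤ 9 + j then 1 else 0)) ^ 2
            = ((j : ℤ) ^ 2 + 2 * j * genChern m) * (if i ≤ m then 1 else 0)
              + genChern m ^ 2 * (if i ≤ 9 + j then 1 else 0) := by
          intro i hi
          have : i ≠ 0 := by rw [Finset.mem_Icc] at hi; omega
          rw [if_neg this]
          split_ifs
          · ring
          · omega
          · ring
          · ring
        rw [Finset.sum_congr rfl hterm, Finset.sum_add_distrib, ← Finset.mul_sum,
          ← Finset.mul_sum]
        have h1 := mul_le_mul_of_nonneg_left (sum_ite_le n m)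
          (by positivity : 0 ≤ (j : ℤ) ^ 2 + 2 * j * genChern m)
        have h2 := mul_le_mul_of_nonneg_left (sum_ite_le n (9 + j)) (sq_nonneg (genChern m))
        refine (add_le_add h1 h2).trans ?_
        have h3 : 0 ≤ (j : ℤ) ^ 2 * (genHead m ^ 2 - m) :=
          mul_nonneg (sq_nonneg _) (sub_nonneg.2 hs)
        have h4 : 0 ≤ (j : ℤ) * genChern m ^ 2 := by positivity
        have h5 : (m : ℤ) = 3 * genHead m - genChern m := by unfold genChern; ring
        simp only [if_true]
        push_cast
        rw [h5] at h3 ⊢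
        nlinarith)
    refine ⟨C, fun A hA => (hC A hA).trans (le_of_eq ?_)⟩
    simp only [conePair, genPair, hj0, if_false, if_true, genHead_nine_add]
    have : ∑ i ∈ Finset.Icc 1 n, (if i = 0 then (j : ℤ) * genHead m + genChern m * 3 else
        j * (if i ≤ m then 1 else 0) + genChern m * (if i ≤ 9 + j then 1 else 0)) * A i
        = j * ∑ i ∈ Finset.Icc 1 n, (if i ≤ m then 1 else 0) * A i
          + genChern m * ∑ i ∈ Finset.Icc 1 n, (if i ≤ 9 + j then 1 else 0) * A i := by
      rw [Finset.mul_sum, Finset.mul_sum, ← Finset.sum_add_distrib]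
      refine Finset.sum_congr rfl fun i hi => ?_
      have : i ≠ 0 := by rw [Finset.mem_Icc] at hi; omega
      rw [if_neg this]; ring
    rw [this]; ring

/-- Abel summation: nonnegative partial sums against a nonnegative antitone weight. -/
lemma sum_mul_nonneg_of_partial_sums (n : ℕ) (e x : ℕ → ℝ)
    (hx : ∀ i ∈ Finset.Icc 1 n, 0 ≤ x i)
    (hanti : ∀ i, 1 ≤ i → i + 1 ≤ n → x (i + 1) ≤ x i)
    (he : ∀ m ≤ n, 0 ≤ ∑ i ∈ Finset.Icc 1 m, e i) :
    0 ≤ ∑ i ∈ Finset.Icc 1 n, e i * x i := by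
  rcases Nat.eq_zero_or_pos n with rfl | hn
  · simp
  have key : ∀ m, 1 ≤ m → m ≤ n →
      x m * ∑ i ∈ Finset.Icc 1 m, e i ≤ ∑ i ∈ Finset.Icc 1 m, e i * x i := by
    intro m hm
    induction m, hm using Nat.le_induction with
    | base => intro _; simp [mul_comm]
    | succ m hm ih =>
      intro hmn
      rw [Finset.sum_Icc_succ_top (by omega), Finset.sum_Icc_succ_top (by omega)]
      have h1 := ih (by omega)
      have h2 := mul_le_mul_of_nonneg_right (hanti m hm hmn) (he m (by omega))
      linarith
  exact (mul_nonneg (hx n (by simp; omega)) (he n le_rfl)).trans (key n hn le_rfl)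

/-- A vector of the `c_1`-nef cone is reduced. -/
lemma c1Nef_reduced {n : ℕ} (hn : 1 ≤ n) {x : ℕ → ℝ} (hx : x ∈ c1Nef n) :
    (∀ i ∈ Finset.Icc 1 n, 0 ≤ x i) ∧ (∀ i, 1 ≤ i → i + 1 ≤ n → x (i + 1) ≤ x i) ∧
      ∑ i ∈ Finset.Icc 1 n, (if i ≤ 3 then 1 else 0) * x i ≤ x 0 := by
  obtain ⟨-, h⟩ := hx
  split_ifs at h with h1 h2
  · subst h1
    refine ⟨fun i hi => ?_, fun i _ _ => by omega, by simpa using h.2.le⟩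
    obtain rfl : i = 1 := by simpa using hi
    exact h.1.le
  · subst h2
    refine ⟨fun i hi => ?_, fun i hi hi' => ?_, ?_⟩
    · rw [Finset.mem_Icc] at hi
      obtain ⟨hi, hi'⟩ := hi
      interval_cases i <;> linarith
    · obtain rfl : i = 1 := by omega
      exact h.2.1
    · simpa [Finset.sum_Icc_succ_top] using h.2.2.le
  · obtain ⟨hpos, hanti, hred, -⟩ := h
    refine ⟨fun i hi => ?_, fun i hi hi' => hanti _ _ hi (by omega) hi', ?_⟩
    · rw [Finset.mem_Icc] at hi
      exact hpos.le.trans (hanti i n hi.1 hi.2 le_rfl)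
    · have hsub : Finset.Icc 1 3 ⊆ Finset.Icc 1 n := Finset.Icc_subset_Icc_right (by omega)
      rw [← Finset.sum_subset hsub fun i hi hi' => by
        have : ¬ i ≤ 3 := by rw [Finset.mem_Icc] at hi hi'; omega
        simp [this]]
      simpa [Finset.sum_Icc_succ_top] using hred

/-- A vector pairing nonnegatively with all generators pairs nonnegatively with every reduced
vector. -/
lemma pairing_nonneg_of_generators {n : ℕ} {x d : ℕ → ℝ}
    (hx : ∀ i ∈ Finset.Icc 1 n, 0 ≤ x i)
    (hanti : ∀ i, 1 ≤ i → i + 1 ≤ n → x (i + 1) ≤ x i)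
    (hred : ∑ i ∈ Finset.Icc 1 n, (if i ≤ 3 then 1 else 0) * x i ≤ x 0)
    (hd : ∀ m ≤ n, 0 ≤ (genHead m : ℝ) * d 0 - ∑ i ∈ Finset.Icc 1 m, d i) :
    0 ≤ d 0 * x 0 - ∑ i ∈ Finset.Icc 1 n, d i * x i := by
  have hd0 : 0 ≤ d 0 := by simpa [genHead] using hd 0 (Nat.zero_le _)
  have hab := sum_mul_nonneg_of_partial_sums n
    (fun i => d 0 * (if i ≤ 3 then 1 else 0) - d i) x hx hanti (fun m hm => by
      rcases Nat.eq_zero_or_pos m with rfl | hm0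
      · simp
      rw [Finset.sum_sub_distrib, ← Finset.mul_sum]
      have : ∑ i ∈ Finset.Icc 1 m, (if i ≤ 3 then (1 : ℝ) else 0) = genHead m := by
        rw [Finset.sum_boole]
        have : (Finset.Icc 1 m).filter (· ≤ 3) = Finset.Icc 1 (min m 3) := by
          ext i; simp only [Finset.mem_filter, Finset.mem_Icc]; omega
        rw [this, Nat.card_Icc]
        have : genHead m = ((min m 3 + 1 - 1 : ℕ) : ℤ) := by unfold genHead; omega
        rw [this]; norm_cast
      rw [this, mul_comm]
      exact hd m hm)
  have h := mul_le_mul_of_nonneg_left hred hd0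
  rw [Finset.mul_sum] at h
  have : ∑ i ∈ Finset.Icc 1 n, (d 0 * (if i ≤ 3 then 1 else 0) - d i) * x i
      = ∑ i ∈ Finset.Icc 1 n, d 0 * ((if i ≤ 3 then 1 else 0) * x i)
        - ∑ i ∈ Finset.Icc 1 n, d i * x i := by
    rw [← Finset.sum_sub_distrib]
    exact Finset.sum_congr rfl fun i _ => by ring
  linarith

/-- A sequence that is nonnegative on the generators of nonnegative first Chern number dominates
a nonnegative multiple of the first Chern number on all generators. -/
lemma exists_mul_genChern_le (n : ℕ) (δ : ℕ → ℝ) (h0 : ∀ m ≤ 9, 0 ≤ δ m)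
    (h1 : ∀ m ≤ 9, ∀ j ≤ n, j ≠ 0 → 0 ≤ (j : ℝ) * δ m + genChern m * δ (9 + j)) :
    ∃ t : ℝ, 0 ≤ t ∧ ∀ m ≤ n, t * genChern m ≤ δ m := by
  obtain ⟨j₀, hj₀, hmax⟩ := Finset.exists_max_image (Finset.range (n + 1))
    (fun j : ℕ => -δ (9 + j) / (j : ℝ)) ⟨0, by simp⟩
  refine ⟨-δ (9 + j₀) / (j₀ : ℝ), by simpa using hmax 0 (by simp), fun m hm => ?_⟩
  rcases le_or_gt m 9 with hm9 | hm9
  · rcases Nat.eq_zero_or_pos j₀ with rfl | hj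
    · simpa using h0 m hm9
    · have hj' : (0 : ℝ) < j₀ := by exact_mod_cast hj
      have := h1 m hm9 j₀ (by simpa [Nat.lt_succ_iff] using hj₀) hj.ne'
      rw [div_mul_eq_mul_div, div_le_iff₀ hj']
      linarith
  · obtain ⟨j, rfl⟩ := Nat.exists_eq_add_of_le hm9.le
    have hj' : (0 : ℝ) < j := by
      have : 0 < j := by omega
      exact_mod_cast this
    have := hmax j (by simp; omega)
    rw [div_le_iff₀ hj'] at this
    have hc : (genChern (9 + j) : ℝ) = -j := by
      rw [genChern, genHead_nine_add]; push_cast; ring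
    rw [hc]; linarith

lemma omegaEval_le_of_conePair_le {n : ℕ} (hn : 1 ≤ n) {A B : ℕ → ℤ}
    (h : conePair n B ≤ conePair n A) {x : ℕ → ℝ} (hx : x ∈ c1Nef n) :
    omegaEval n x B ≤ omegaEval n x A := by
  obtain ⟨hpos, hanti, hred⟩ := c1Nef_reduced hn hx
  obtain ⟨t, ht, htle⟩ := exists_mul_genChern_le n
    (fun m => ((genPair n m A - genPair n m B : ℤ) : ℝ))
    (fun m hm => by
      have := h (⟨m, by omega⟩, ⟨0, by omega⟩)
      simp only [conePair, if_true] at this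
      exact_mod_cast sub_nonneg.2 this)
    (fun m hm j hj hj0 => by
      have := h (⟨m, by omega⟩, ⟨j, by omega⟩)
      simp only [conePair, hj0, if_false] at this
      have h' : 0 ≤ (j : ℤ) * (genPair n m A - genPair n m B)
          + genChern m * (genPair n (9 + j) A - genPair n (9 + j) B) := by linarith
      exact_mod_cast h')
  have key := pairing_nonneg_of_generators
    (d := fun i => (A i : ℝ) - B i - t * (if i = 0 then 3 else 1)) hpos hanti hred
    (fun m hm => by
      have h1 := htle m hm
      have hsum : ∀ D : ℕ → ℤ, ∑ i ∈ Finset.Icc 1 n, (if i ≤ m then 1 else 0) * D i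
          = ∑ i ∈ Finset.Icc 1 m, D i := by
        intro D
        rw [← Finset.sum_subset (Finset.Icc_subset_Icc_right hm) fun i hi hi' => by
          have : ¬ i ≤ m := by rw [Finset.mem_Icc] at hi hi'; omega
          simp [this]]
        refine Finset.sum_congr rfl fun i hi => ?_
        rw [if_pos (Finset.mem_Icc.1 hi).2, one_mul]
      have hsub : ∑ i ∈ Finset.Icc 1 m, ((A i : ℝ) - B i - t * (if i = 0 then 3 else 1))
          = ∑ i ∈ Finset.Icc 1 m, (A i : ℝ) - ∑ i ∈ Finset.Icc 1 m, (B i : ℝ) - m * t := by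
        have : (m : ℝ) * t = ∑ i ∈ Finset.Icc 1 m, t := by simp
        rw [this, ← Finset.sum_sub_distrib, ← Finset.sum_sub_distrib]
        refine Finset.sum_congr rfl fun i hi => ?_
        have : i ≠ 0 := by rw [Finset.mem_Icc] at hi; omega
        rw [if_neg this, mul_one]
      simp only [genPair, genChern, hsum] at h1
      push_cast at h1
      rw [hsub]
      simp only [if_true]
      linarith)
  have hsub : ∑ i ∈ Finset.Icc 1 n, ((A i : ℝ) - B i - t * (if i = 0 then 3 else 1)) * x i
      = ∑ i ∈ Finset.Icc 1 n, (A i : ℝ) * x i - ∑ i ∈ Finset.Icc 1 n, (B i : ℝ) * x i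
        - t * ∑ i ∈ Finset.Icc 1 n, x i := by
    rw [Finset.mul_sum, ← Finset.sum_sub_distrib, ← Finset.sum_sub_distrib]
    refine Finset.sum_congr rfl fun i hi => ?_
    have : i ≠ 0 := by rw [Finset.mem_Icc] at hi; omega
    rw [if_neg this]; ring
  rw [hsub] at key
  simp only [if_true] at key
  have := mul_nonneg ht hx.1.le
  unfold omegaEval
  linarith

/-- Dickson's lemma for sets of classes with integer invariants bounded below. -/
lemma exists_finset_dominating {α ι : Type*} [Finite ι] (U : Set α) (F : α → ι → ℤ)
    (hF : ∀ i, ∃ C : ℤ, ∀ a ∈ U, 0 ≤ F a i + C) :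
    ∃ S : Finset α, (↑S : Set α) ⊆ U ∧ ∀ a ∈ U, ∃ b ∈ S, F b ≤ F a := by
  choose C hC using hF
  let G : α → ι → ℕ := fun a i => (F a i + C i).toNat
  have hfin : {g | Minimal (· ∈ G '' U) g}.Finite :=
    WellQuasiOrderedLE.finite_of_isAntichain (setOfPred_minimal_antichain _)
  have hpre : ∀ g : {g // Minimal (· ∈ G '' U) g}, ∃ a ∈ U, G a = g := fun g => g.2.prop
  choose r hrU hr using hpre
  have : Finite {g // Minimal (· ∈ G '' U) g} := hfin.to_subtype
  refine ⟨(Set.finite_range r).toFinset, ?_, fun a ha => ?_⟩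
  · rw [Set.Finite.coe_toFinset]
    exact Set.range_subset_iff.2 hrU
  · obtain ⟨g, hga, hg⟩ := exists_minimal_le_of_wellFoundedLT (· ∈ G '' U) (G a)
      (Set.mem_image_of_mem G ha)
    refine ⟨r ⟨g, hg⟩, by simp, fun i => ?_⟩
    have hle : G (r ⟨g, hg⟩) i ≤ G a i := by rw [hr]; exact hga i
    have h1 := hC i _ (hrU ⟨g, hg⟩)
    have h2 := hC i a ha
    change (F (r ⟨g, hg⟩) i + C i).toNat ≤ (F a i + C i).toNat at hle
    change F (r ⟨g, hg⟩) i ≤ F a i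
    omega

lemma U5_nonempty (n k : ℕ) (hk : 1 ≤ k) : (U5 n k).Nonempty := by
  refine ⟨fun i => if i = 0 then (k : ℤ) else 0, by simpa using Nat.lt_of_lt_of_le Nat.zero_lt_one hk, ?_, fun i hi => ?_⟩
  · have : ∑ i ∈ Finset.Icc 1 n, ((if i = 0 then (k : ℤ) else 0) ^ 2 + if i = 0 then (k : ℤ) else 0)
        = 0 := Finset.sum_eq_zero fun i hi => by
      have : i ≠ 0 := by rw [Finset.mem_Icc] at hi; omega
      simp [this]
    unfold indCl
    rw [this]
    simp only [if_true]
    nlinarith [(Nat.cast_nonneg k : (0 : ℤ) ≤ k)]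
  · have : i ≠ 0 := by omega
    simp [this]

/-- The `k`-th tamed capacity is a tropical polynomial on the `c_1`-nef cone:
there are finitely many classes `A_1, …, A_m ∈ U_5^{(k)}` such that for every
`x ∈ P^{c_1>0}` the infimum `inf {ω_x(A) | A ∈ U_5^{(k)}}` is attained and
equals `min {ω_x(A_1), …, ω_x(A_m)}`. -/
theorem tamed_capacity_tropical (n k : ℕ) (hn : 1 ≤ n) (hk : 1 ≤ k) :
    ∃ S : Finset (ℕ → ℤ), ∃ hS : S.Nonempty, (↑S : Set (ℕ → ℤ)) ⊆ U5 n k ∧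
      ∀ x ∈ c1Nef n,
        IsLeast (omegaEval n x '' U5 n k)
          ((S.image (omegaEval n x)).min' (hS.image _)) := by
  obtain ⟨S, hSU, hdom⟩ := exists_finset_dominating (U5 n k) (conePair n) (conePair_bddBelow n k)
  obtain ⟨A₀, hA₀⟩ := U5_nonempty n k hk
  obtain ⟨B₀, hB₀, -⟩ := hdom A₀ hA₀
  refine ⟨S, ⟨B₀, hB₀⟩, hSU, fun x hx => ⟨?_, ?_⟩⟩
  · obtain ⟨B, hB, hBeq⟩ := Finset.mem_image.1
      (Finset.min'_mem (S.image (omegaEval n x)) (Finset.Nonempty.image ⟨B₀, hB₀⟩ _))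
    exact ⟨B, hSU hB, hBeq⟩
  · rintro _ ⟨A, hA, rfl⟩
    obtain ⟨B, hB, hle⟩ := hdom A hA
    exact (Finset.min'_le _ _ (Finset.mem_image_of_mem _ hB)).trans
      (omegaEval_le_of_conePair_le hn hle hx)
end

section
/- Fix integers 3 ≤ n ≤ 8 and k ≥ 1. There exist finitely many classes B_1, ..., B_M ∈ U_5^{(k)} such that for every g ∈ D_{K_0} and every x ∈ P^{c_1>0}, one has inf{ ω_x(g(A)) : A ∈ U_5^{(k)} } = min{ ω_x(g(B_1)), ..., ω_x(g(B_M)) }. (That is, the capacity function is a tropical polynomial on the whole symplectic K_0-cone, which is the union of the D_{K_0}-translates of the c_1-nef cone.) -/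
/-- The Cremona reflection
`(a, b_1, b_2, b_3, b_4, …) ↦ (2a - b_1 - b_2 - b_3, a - b_2 - b_3, a - b_1 - b_3, a - b_1 - b_2, b_4, …)`. -/
def cremona : (ℕ → ℤ) → (ℕ → ℤ) := fun A i =>
  if i = 0 then 2 * A 0 - A 1 - A 2 - A 3
  else if i = 1 then A 0 - A 2 - A 3
  else if i = 2 then A 0 - A 1 - A 3
  else if i = 3 then A 0 - A 1 - A 2
  else A i

lemma cremona_involutive : Function.Involutive cremona := by
  intro A
  funext i
  match i with
  | 0 => simp only [cremona]; norm_num; ring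
  | 1 => simp only [cremona]; norm_num; ring
  | 2 => simp only [cremona]; norm_num; ring
  | 3 => simp only [cremona]; norm_num; ring
  | (m + 4) =>
    have h1 : m + 4 ≠ 1 := by omega
    have h2 : m + 4 ≠ 2 := by omega
    have h3 : m + 4 ≠ 3 := by omega
    simp only [cremona]
    norm_num [h1, h2, h3]

/-- The Cremona reflection as a permutation of the lattice of classes. -/
def cremonaPerm : Equiv.Perm (ℕ → ℤ) :=
  Function.Involutive.toPerm cremona cremona_involutive

/-- The permutation of classes induced by a permutation `σ` of the coordinates. -/
def permEquiv (σ : Equiv.Perm ℕ) : Equiv.Perm (ℕ → ℤ) :=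
  σ.arrowCongr (Equiv.refl ℤ)

/-- `D_{K_0}`: the group generated by the Cremona reflection together with the
permutations of the coordinates `b_1, …, b_n` (fixing `a = b_0`). -/
def DK0 (n : ℕ) : Subgroup (Equiv.Perm (ℕ → ℤ)) :=
  Subgroup.closure ({cremonaPerm} ∪
    {e | ∃ σ : Equiv.Perm ℕ, σ 0 = 0 ∧ (∀ i, n < i → σ i = i) ∧ e = permEquiv σ})

/-- The intersection pairing on classes in `⟨H, E_1, …, E_8⟩`. -/
def pairing (u v : ℕ → ℤ) : ℤ :=
  u 0 * v 0 - ∑ i ∈ Finset.Icc 1 8, u i * v i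

/-- The anticanonical class `3H - E_1 - ⋯ - E_8`. -/
def antiCanonical : ℕ → ℤ := fun i => if i = 0 then 3 else if i ≤ 8 then 1 else 0

/-- The generators `H, H - E_1, 2H - E_1 - E_2, 3H - E_1 - ⋯ - E_j` of the cone of reduced
vectors. -/
def reducedGen (j : ℕ) : ℕ → ℤ := fun i =>
  if i = 0 then max 1 (min (j : ℤ) 3) else if i ≤ j then 1 else 0

/-- Classes supported on `H, E_1, …, E_8`, of nonnegative square and with anticanonical degree
between `0` and `9`. -/
def boundedForward : Set (ℕ → ℤ) :=
  {w | (∀ i, 8 < i → w i = 0) ∧ 0 ≤ pairing w w ∧ 0 ≤ pairing w antiCanonical ∧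
    pairing w antiCanonical ≤ 9}

lemma pairing_antiCanonical (u : ℕ → ℤ) :
    pairing u antiCanonical = 3 * u 0 - ∑ i ∈ Finset.Icc 1 8, u i := by
  have h : ∑ i ∈ Finset.Icc 1 8, u i * antiCanonical i = ∑ i ∈ Finset.Icc 1 8, u i := by
    refine Finset.sum_congr rfl fun i hi => ?_
    rw [Finset.mem_Icc] at hi
    have h0 : i ≠ 0 := by omega
    simp [antiCanonical, h0, hi.2]
  rw [pairing, h, antiCanonical, if_pos rfl]
  ring

lemma pairing_cremona (u v : ℕ → ℤ) : pairing (cremona u) (cremona v) = pairing u v := by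
  simp only [pairing, cremona, Finset.sum_Icc_succ_top, Nat.reduceLeDiff, Nat.reduceAdd,
    Finset.Icc_self, Finset.sum_singleton]
  norm_num [Finset.sum_Icc_succ_top]
  ring

lemma cremona_antiCanonical : cremona antiCanonical = antiCanonical := by
  funext i
  simp only [cremona, antiCanonical]
  split_ifs <;> first | contradiction | omega

lemma mem_Icc_iff_of_fix {m n : ℕ} (hn : n ≤ m) (σ : Equiv.Perm ℕ) (h0 : σ 0 = 0)
    (hσ : ∀ i, n < i → σ i = i) (i : ℕ) : σ i ∈ Finset.Icc 1 m ↔ i ∈ Finset.Icc 1 m := by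
  simp only [Finset.mem_Icc]
  by_cases hi : i = 0
  · subst hi; rw [h0]
  by_cases hm : m < i
  · rw [hσ i (by omega)]
  have h1 : σ i ≠ 0 := fun h => hi (σ.injective (h.trans h0.symm))
  have h2 : ¬ m < σ i := fun h => hm (by
    have := σ.injective (hσ (σ i) (by omega))
    omega)
  omega

/-- Every element of `D_{K_0}` is an isometry fixing the anticanonical class and the coordinates
beyond the eighth. -/
lemma DK0_isometry {n : ℕ} (hn : n ≤ 8) {g : Equiv.Perm (ℕ → ℤ)} (hg : g ∈ DK0 n) :
    (∀ u v, pairing (g u) (g v) = pairing u v) ∧ g antiCanonical = antiCanonical ∧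
      ∀ u i, 8 < i → g u i = u i := by
  induction hg using Subgroup.closure_induction with
  | mem g hg =>
    rcases hg with rfl | ⟨σ, h0, hσ, rfl⟩
    · refine ⟨pairing_cremona, cremona_antiCanonical, fun u i hi => ?_⟩
      change cremona u i = u i
      have h0 : i ≠ 0 := by omega
      have h1 : i ≠ 1 := by omega
      have h2 : i ≠ 2 := by omega
      have h3 : i ≠ 3 := by omega
      simp only [cremona, h0, h1, h2, h3, if_false]
    · have h0' : σ.symm 0 = 0 := by rw [Equiv.symm_apply_eq, h0]
      have hσ' : ∀ i, n < i → σ.symm i = i := fun i hi => by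
        rw [Equiv.symm_apply_eq, hσ i hi]
      have hval : ∀ u i, permEquiv σ u i = u (σ.symm i) := fun u i => rfl
      have hmem := mem_Icc_iff_of_fix hn σ.symm h0' hσ'
      refine ⟨fun u v => ?_, ?_, fun u i hi => ?_⟩
      · simp only [pairing, hval, h0']
        congr 1
        exact Finset.sum_equiv σ.symm (fun i => (hmem i).symm) fun i _ => rfl
      · funext i
        have := hmem i
        simp only [Finset.mem_Icc] at this
        rw [hval]
        simp only [antiCanonical]
        by_cases hi : i = 0
        · subst hi; rw [h0']
        have h1 : σ.symm i ≠ 0 := fun h => hi (σ.symm.injective (h.trans h0'.symm))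
        rw [if_neg hi, if_neg h1]
        exact if_congr (by omega) rfl rfl
      · rw [hval, hσ' i (by omega)]
  | one => exact ⟨fun _ _ => rfl, rfl, fun _ _ _ => rfl⟩
  | mul g h _ _ ihg ihh =>
    refine ⟨fun u v => ?_, ?_, fun u i hi => ?_⟩
    · rw [Equiv.Perm.mul_apply, Equiv.Perm.mul_apply, ihg.1, ihh.1]
    · rw [Equiv.Perm.mul_apply, ihh.2.1, ihg.2.1]
    · rw [Equiv.Perm.mul_apply, ihg.2.2 _ _ hi, ihh.2.2 _ _ hi]
  | inv g _ ih =>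
    refine ⟨fun u v => ?_, ?_, fun u i hi => ?_⟩
    · rw [← ih.1, Equiv.Perm.coe_inv, Equiv.apply_symm_apply, Equiv.apply_symm_apply]
    · rw [Equiv.Perm.inv_eq_iff_eq, ih.2.1]
    · rw [← ih.2.2 (g⁻¹ u) i hi, Equiv.Perm.coe_inv, Equiv.apply_symm_apply]

lemma reducedGen_mem {j : ℕ} (hj : j ≤ 8) : reducedGen j ∈ boundedForward := by
  refine ⟨fun i hi => ?_, ?_⟩
  · have h0 : i ≠ 0 := by omega
    have h1 : ¬ i ≤ j := by omega
    simp [reducedGen, h0, h1]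
  · rw [pairing_antiCanonical, pairing]
    interval_cases j <;> decide

lemma boundedForward_map {n : ℕ} (hn : n ≤ 8) {g : Equiv.Perm (ℕ → ℤ)} (hg : g ∈ DK0 n)
    {w : ℕ → ℤ} (hw : w ∈ boundedForward) : g w ∈ boundedForward := by
  obtain ⟨h1, h2, h3⟩ := DK0_isometry hn hg
  obtain ⟨w1, w2, w3⟩ := hw
  have h : pairing (g w) antiCanonical = pairing w antiCanonical := by
    conv_lhs => rw [← h2]
    exact h1 _ _
  exact ⟨fun i hi => by rw [h3 _ _ hi, w1 i hi], by rwa [h1], by rwa [h]⟩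

lemma boundedForward_bounds {w : ℕ → ℤ} (hw : w ∈ boundedForward) : 0 ≤ w 0 ∧ w 0 ≤ 54 := by
  obtain ⟨-, w2, w3, w4⟩ := hw
  rw [pairing_antiCanonical] at w3 w4
  rw [pairing] at w2
  have hcs := sq_sum_le_card_mul_sum_sq (s := Finset.Icc 1 8) (f := w)
  simp only [Nat.card_Icc, Nat.reduceAdd, Nat.reduceSub, Nat.cast_ofNat, pow_two] at hcs
  set s := ∑ i ∈ Finset.Icc 1 8, w i
  constructor
  · by_contra! h
    nlinarith
  · by_contra! h
    nlinarith

lemma boundedForward_finite : boundedForward.Finite := by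
  let ext : (Fin 9 → ℤ) → ℕ → ℤ := fun f i => if h : i < 9 then f ⟨i, h⟩ else 0
  refine ((Set.finite_Icc (fun _ => (-54 : ℤ)) (fun _ => 54)).image ext).subset fun w hw => ?_
  obtain ⟨h0, h54⟩ := boundedForward_bounds hw
  obtain ⟨w1, w2, -⟩ := hw
  rw [pairing] at w2
  have hi : ∀ i < 9, -54 ≤ w i ∧ w i ≤ 54 := by
    intro i hi
    rcases Nat.eq_zero_or_pos i with rfl | hp
    · omega
    have := Finset.single_le_sum (f := fun i => w i * w i) (fun i _ => mul_self_nonneg _)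
      (Finset.mem_Icc.2 ⟨hp, (by omega : i ≤ 8)⟩)
    refine abs_le.1 (abs_le_of_sq_le_sq (a := w i) (b := 54) ?_ (by norm_num))
    nlinarith
  refine ⟨fun i => w i, ⟨fun i => (hi i i.2).1, fun i => (hi i i.2).2⟩, ?_⟩
  funext i
  by_cases h : i < 9
  · simp [ext, h]
  · simp [ext, h, w1 i (by omega)]

/-- The reverse Cauchy–Schwarz inequality, in its sign form. -/
lemma pairing_nonneg {u v : ℕ → ℤ} (hu : 0 ≤ pairing u u) (hv : 0 ≤ pairing v v)
    (hu0 : 0 ≤ u 0) (hv0 : 0 ≤ v 0) : 0 ≤ pairing u v := by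
  rw [pairing] at *
  have hcs := Finset.sum_mul_sq_le_sq_mul_sq (Finset.Icc 1 8) u v
  have hpos : 0 ≤ ∑ i ∈ Finset.Icc 1 8, v i * v i :=
    Finset.sum_nonneg fun i _ => mul_self_nonneg _
  simp only [pow_two (u _), pow_two (v _)] at hcs
  have h : (∑ i ∈ Finset.Icc 1 8, u i * v i) ^ 2 ≤ (u 0 * v 0) ^ 2 := by
    refine hcs.trans ?_
    calc _ ≤ (u 0 * u 0) * (v 0 * v 0) :=
          mul_le_mul (by linarith) (by linarith) hpos (mul_self_nonneg _)
      _ = _ := by ring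
  linarith [abs_le_of_sq_le_sq' h (mul_nonneg hu0 hv0)]

lemma indCl_eq_pairing {n : ℕ} (hn : n ≤ 8) {A : ℕ → ℤ} (hA : ∀ i, n < i → A i = 0) :
    indCl n A = pairing A A + pairing A antiCanonical := by
  have h : ∑ i ∈ Finset.Icc 1 n, (A i ^ 2 + A i) = ∑ i ∈ Finset.Icc 1 8, (A i ^ 2 + A i) := by
    refine Finset.sum_subset (Finset.Icc_subset_Icc_right hn) fun i hi hi' => ?_
    simp only [Finset.mem_Icc] at hi hi'
    rw [hA i (by omega)]
    rfl
  rw [indCl, h, pairing_antiCanonical, pairing, Finset.sum_add_distrib]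
  simp only [pow_two]
  ring

lemma pairing_lower_bound {n k : ℕ} (hn : n ≤ 8) {A w : ℕ → ℤ} (hA : A ∈ U5 n k)
    (hw : w ∈ boundedForward) : 0 ≤ pairing w A + 5 := by
  obtain ⟨hA0, hind, hsupp⟩ := hA
  rw [indCl_eq_pairing hn hsupp] at hind
  have hlin : ∀ u : ℕ → ℤ, pairing u (fun i => 2 * A i + antiCanonical i) =
      2 * pairing u A + pairing u antiCanonical := by
    intro u
    simp only [pairing, mul_add, Finset.sum_add_distrib, mul_left_comm _ (2 : ℤ),
      ← Finset.mul_sum]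
    ring
  have hcomm : ∀ u v : ℕ → ℤ, pairing u v = pairing v u := fun u v => by
    simp only [pairing, mul_comm]
  have hcc : pairing antiCanonical antiCanonical = 1 := by decide
  have h : 0 ≤ pairing w (fun i => 2 * A i + antiCanonical i) := by
    refine pairing_nonneg hw.2.1 ?_ (boundedForward_bounds hw).1 ?_
    · rw [hlin, hcomm _ A, hcomm _ antiCanonical, hlin, hlin, hcomm antiCanonical A, hcc]
      omega
    · simp only [antiCanonical, if_pos]
      omega
  rw [hlin] at h
  have := hw.2.2.2
  omega

/-- Dickson's lemma: a set on which finitely many integer functions are bounded below contains a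
finite subset dominating it from below in all of these functions. -/
lemma exists_finite_dominating {α ι : Type*} [Finite ι] (U : Set α) (f : ι → α → ℤ) (c : ℤ)
    (hf : ∀ i, ∀ a ∈ U, 0 ≤ f i a + c) :
    ∃ S : Finset α, (S : Set α) ⊆ U ∧ ∀ a ∈ U, ∃ b ∈ S, ∀ i, f i b ≤ f i a := by
  let F : α → ι → ℕ := fun a i => (f i a + c).toNat
  have hfin : {m | Minimal (· ∈ F '' U) m}.Finite :=
    WellQuasiOrderedLE.finite_of_isAntichain (setOfPred_minimal_antichain _)
  choose r hrU hr using fun m : {m | Minimal (· ∈ F '' U) m} => m.2.prop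
  have := hfin.fintype
  classical
  refine ⟨Finset.univ.image r, fun b hb => ?_, fun a ha => ?_⟩
  · obtain ⟨m, -, rfl⟩ := Finset.mem_image.1 hb
    exact hrU m
  · obtain ⟨m, hma, hm⟩ :=
      exists_minimal_le_of_wellFoundedLT (· ∈ F '' U) (F a) (Set.mem_image_of_mem F ha)
    refine ⟨r ⟨m, hm⟩, Finset.mem_image_of_mem r (Finset.mem_univ _), fun i => ?_⟩
    have h1 : F (r ⟨m, hm⟩) i ≤ F a i := by rw [hr]; exact hma i
    have h2 := hf i _ (hrU ⟨m, hm⟩)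
    have h3 := hf i a ha
    simp only [F] at h1
    omega

/-- Comparing two classes on the generators of the cone of reduced vectors suffices to compare
them on the whole cone. -/
lemma omegaEval_le_of_reducedGen {n : ℕ} (hn3 : 3 ≤ n) (hn8 : n ≤ 8) {x : ℕ → ℝ}
    (hx : x ∈ c1Nef n) {A B : ℕ → ℤ}
    (h : ∀ j ≤ 8, pairing (reducedGen j) B ≤ pairing (reducedGen j) A) :
    omegaEval n x B ≤ omegaEval n x A := by
  obtain ⟨-, hx⟩ := hx
  rw [if_neg (by omega), if_neg (by omega)] at hx
  obtain ⟨hpos, hanti, hred, -⟩ := hx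
  let y : ℕ → ℝ := fun i => if i ≤ n then x i else 0
  have hy : ∀ C, omegaEval n x C = omegaEval 8 y C := by
    intro C
    have h1 : ∑ i ∈ Finset.Icc 1 n, (C i : ℝ) * x i = ∑ i ∈ Finset.Icc 1 n, (C i : ℝ) * y i :=
      Finset.sum_congr rfl fun i hi => by simp [y, (Finset.mem_Icc.1 hi).2]
    have h2 : ∑ i ∈ Finset.Icc 1 n, (C i : ℝ) * y i = ∑ i ∈ Finset.Icc 1 8, (C i : ℝ) * y i := by
      refine Finset.sum_subset (Finset.Icc_subset_Icc_right hn8) fun i hi hi' => ?_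
      simp only [Finset.mem_Icc] at hi hi'
      have : ¬ i ≤ n := by omega
      simp [y, this]
    rw [omegaEval, omegaEval, h1, h2]
    simp [y]
  have hnn : ∀ i, 1 ≤ i → 0 ≤ y i := by
    intro i hi
    by_cases hin : i ≤ n
    · simpa [y, hin] using hpos.le.trans (hanti i n hi hin le_rfl)
    · simp [y, hin]
  have hstep : ∀ i, 1 ≤ i → 0 ≤ y i - y (i + 1) := by
    intro i hi
    by_cases hin : i + 1 ≤ n
    · have : i ≤ n := by omega
      simpa [y, hin, this] using hanti i (i + 1) hi (by omega) hin
    · simpa [y, hin] using hnn i hi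
  have hy0 : 0 ≤ y 0 - y 1 - y 2 - y 3 := by
    have h1 : 1 ≤ n := by omega
    have h2 : 2 ≤ n := by omega
    simp only [y, h1, h2, hn3, if_true, Nat.zero_le]
    linarith
  have hg : ∀ j ≤ 8, (0 : ℝ) ≤ ((pairing (reducedGen j) A - pairing (reducedGen j) B : ℤ) : ℝ) :=
    fun j hj => by exact_mod_cast sub_nonneg.2 (h j hj)
  have p0 := mul_nonneg hy0 (hg 0 (by norm_num))
  have p1 := mul_nonneg (hstep 1 le_rfl) (hg 1 (by norm_num))
  have p2 := mul_nonneg (hstep 2 (by norm_num)) (hg 2 (by norm_num))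
  have p3 := mul_nonneg (hstep 3 (by norm_num)) (hg 3 (by norm_num))
  have p4 := mul_nonneg (hstep 4 (by norm_num)) (hg 4 (by norm_num))
  have p5 := mul_nonneg (hstep 5 (by norm_num)) (hg 5 (by norm_num))
  have p6 := mul_nonneg (hstep 6 (by norm_num)) (hg 6 (by norm_num))
  have p7 := mul_nonneg (hstep 7 (by norm_num)) (hg 7 (by norm_num))
  have p8 := mul_nonneg (hnn 8 (by norm_num)) (hg 8 le_rfl)
  rw [hy, hy]
  generalize y = y at *
  norm_num [pairing, reducedGen, omegaEval, Finset.sum_Icc_succ_top] at p0 p1 p2 p3 p4 p5 p6 p7 p8 ⊢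
  linarith

/-- For `3 ≤ n ≤ 8`, the capacity function is a tropical polynomial on the whole
symplectic `K_0`-cone: there are finitely many `B_1, …, B_M ∈ U_5^{(k)}` with
`inf {ω_x(g(A)) | A ∈ U_5^{(k)}} = min {ω_x(g(B_1)), …, ω_x(g(B_M))}` for every
`g ∈ D_{K_0}` and `x ∈ P^{c_1>0}`. -/
theorem tamed_capacity_tropical_K0cone (n k : ℕ) (hn3 : 3 ≤ n) (hn8 : n ≤ 8)
    (hk : 1 ≤ k) :
    ∃ S : Finset (ℕ → ℤ), ∃ hS : S.Nonempty, (↑S : Set (ℕ → ℤ)) ⊆ U5 n k ∧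
      ∀ g ∈ DK0 n, ∀ x ∈ c1Nef n,
        IsGLB ((fun A => omegaEval n x (g A)) '' U5 n k)
          ((S.image fun A => omegaEval n x (g A)).min' (hS.image _)) := by
  have := boundedForward_finite.to_subtype
  obtain ⟨S, hSU, hS⟩ := exists_finite_dominating (U5 n k)
    (fun (w : boundedForward) A => pairing w.1 A) 5
    fun w A hA => pairing_lower_bound hn8 hA w.2
  have hne : (fun i => if i = 0 then (k : ℤ) else 0) ∈ U5 n k := by
    refine ⟨by simp only [if_pos]; omega, ?_, fun i hi => if_neg (by omega)⟩
    have h : ∑ i ∈ Finset.Icc 1 n, (((if i = 0 then (k : ℤ) else 0) ^ 2) +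
        (if i = 0 then (k : ℤ) else 0)) = 0 := Finset.sum_eq_zero fun i hi => by
      have : i ≠ 0 := by have := (Finset.mem_Icc.1 hi).1; omega
      simp [this]
    rw [indCl, h]
    simp only [if_pos]
    nlinarith
  obtain ⟨B₀, hB₀, -⟩ := hS _ hne
  refine ⟨S, ⟨B₀, hB₀⟩, hSU, fun g hg x hx => ⟨?_, ?_⟩⟩
  · rintro _ ⟨A, hA, rfl⟩
    obtain ⟨B, hB, hBA⟩ := hS A hA
    refine (Finset.min'_le _ _ (Finset.mem_image_of_mem _ hB)).trans
      (omegaEval_le_of_reducedGen hn3 hn8 hx fun j hj => ?_)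
    have hmove : ∀ C, pairing (reducedGen j) (g C) = pairing (g⁻¹ (reducedGen j)) C := fun C => by
      rw [← (DK0_isometry hn8 hg).1 (g⁻¹ _), Equiv.Perm.coe_inv, Equiv.apply_symm_apply]
    simp only [hmove]
    exact hBA ⟨_, boundedForward_map hn8 (inv_mem hg) (reducedGen_mem hj)⟩
  · intro b hb
    refine Finset.le_min' _ _ _ fun z hz => ?_
    obtain ⟨B, hB, rfl⟩ := Finset.mem_image.1 hz
    exact hb ⟨B, hSU hB, rfl⟩
end

section
/- Fix integers n ≥ 3 and k ≥ 1. Every φ ∈ D_{K_0} satisfies φ(U_5^{(k)}) = U_5^{(k)}. -/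
lemma sum_Icc_one_eq_add {n : ℕ} (hn : 3 ≤ n) (f : ℕ → ℤ) :
    ∑ i ∈ Finset.Icc 1 n, f i = f 1 + f 2 + f 3 + ∑ i ∈ Finset.Icc 4 n, f i := by
  rw [← Finset.add_sum_Ioc_eq_sum_Icc (by omega : 1 ≤ n)]
  have h1 : Finset.Ioc 1 n = Finset.Icc 2 n := by ext; simp; omega
  have h2 : Finset.Ioc 2 n = Finset.Icc 3 n := by ext; simp; omega
  have h3 : Finset.Ioc 3 n = Finset.Icc 4 n := by ext; simp; omega
  rw [h1, ← Finset.add_sum_Ioc_eq_sum_Icc (by omega : 2 ≤ n), h2,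
    ← Finset.add_sum_Ioc_eq_sum_Icc hn, h3]
  ring

lemma cremona_apply_of_three_lt (A : ℕ → ℤ) {i : ℕ} (hi : 3 < i) : cremona A i = A i := by
  simp only [cremona]
  split_ifs <;> omega

lemma indCl_cremona {n : ℕ} (hn : 3 ≤ n) (A : ℕ → ℤ) : indCl n (cremona A) = indCl n A := by
  have h : ∑ i ∈ Finset.Icc 4 n, ((cremona A i) ^ 2 + cremona A i) =
      ∑ i ∈ Finset.Icc 4 n, ((A i) ^ 2 + A i) :=
    Finset.sum_congr rfl fun i hi ↦ by
      rw [cremona_apply_of_three_lt A (Finset.mem_Icc.1 hi).1]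
  rw [indCl, indCl, sum_Icc_one_eq_add hn, sum_Icc_one_eq_add hn, h]
  simp [cremona]
  ring

lemma sq_add_self_nonneg (b : ℤ) : 0 ≤ b ^ 2 + b := by
  rcases le_or_gt 0 b with h | h <;> nlinarith

lemma cremona_zero_pos {n : ℕ} (hn : 3 ≤ n) {A : ℕ → ℤ} (hA : 0 < A 0)
    (hind : 2 ≤ indCl n A) : 0 < cremona A 0 := by
  have h : 0 ≤ ∑ i ∈ Finset.Icc 4 n, ((A i) ^ 2 + A i) :=
    Finset.sum_nonneg fun i _ ↦ sq_add_self_nonneg (A i)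
  rw [indCl, sum_Icc_one_eq_add hn] at hind
  change 0 < 2 * A 0 - A 1 - A 2 - A 3
  by_contra! hs
  have hsq : (2 * (2 * A 0) + 3) ^ 2 ≤ (2 * (A 1 + A 2 + A 3) + 3) ^ 2 :=
    pow_le_pow_left₀ (by omega) (by omega) 2
  nlinarith [sq_nonneg (A 1 - A 2), sq_nonneg (A 1 - A 3), sq_nonneg (A 2 - A 3),
    sq_nonneg (2 * A 0 - 3)]

lemma mapsTo_cremona_U5 {n k : ℕ} (hn : 3 ≤ n) (hk : 1 ≤ k) :
    Set.MapsTo cremona (U5 n k) (U5 n k) := fun A ⟨h0, hind, hA⟩ ↦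
  ⟨cremona_zero_pos hn h0 (by omega), by rwa [indCl_cremona hn],
    fun i hi ↦ by rw [cremona_apply_of_three_lt A (by omega), hA i hi]⟩

lemma permEquiv_apply (σ : Equiv.Perm ℕ) (A : ℕ → ℤ) (i : ℕ) :
    permEquiv σ A i = A (σ.symm i) := rfl

lemma perm_apply_mem_Icc {n : ℕ} {σ : Equiv.Perm ℕ} (h0 : σ 0 = 0)
    (hσ : ∀ i, n < i → σ i = i) {i : ℕ} (hi : i ∈ Finset.Icc 1 n) : σ i ∈ Finset.Icc 1 n := by
  rw [Finset.mem_Icc] at hi ⊢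
  constructor
  · by_contra! h
    have := σ.injective ((Nat.lt_one_iff.1 h).trans h0.symm)
    omega
  · by_contra! h
    have := σ.injective (hσ _ h)
    omega

lemma indCl_permEquiv {n : ℕ} {σ : Equiv.Perm ℕ} (h0 : σ 0 = 0)
    (hσ : ∀ i, n < i → σ i = i) (A : ℕ → ℤ) : indCl n (permEquiv σ A) = indCl n A := by
  have h0' : σ.symm 0 = 0 := σ.symm_apply_eq.2 h0.symm
  have hσ' : ∀ i, n < i → σ.symm i = i := fun i hi ↦ σ.symm_apply_eq.2 (hσ i hi).symm
  simp only [indCl, permEquiv_apply, h0']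
  congr 1
  refine Finset.sum_equiv σ.symm (fun i ↦ ⟨perm_apply_mem_Icc h0' hσ', fun h ↦ ?_⟩)
    fun _ _ ↦ rfl
  simpa using perm_apply_mem_Icc h0 hσ h

lemma mapsTo_permEquiv_U5 {n : ℕ} (k : ℕ) {σ : Equiv.Perm ℕ} (h0 : σ 0 = 0)
    (hσ : ∀ i, n < i → σ i = i) : Set.MapsTo (permEquiv σ) (U5 n k) (U5 n k) := by
  rintro A ⟨hpos, hind, hA⟩
  refine ⟨?_, by rwa [indCl_permEquiv h0 hσ], fun i hi ↦ ?_⟩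
  · rwa [permEquiv_apply, σ.symm_apply_eq.2 h0.symm]
  · rw [permEquiv_apply, σ.symm_apply_eq.2 (hσ i hi).symm, hA i hi]

lemma image_eq_of_mapsTo_of_mapsTo_symm {α : Type*} {e : Equiv.Perm α} {s : Set α}
    (h : Set.MapsTo e s s) (h' : Set.MapsTo e.symm s s) : e '' s = s :=
  h.image_subset.antisymm fun x hx ↦ ⟨e.symm x, h' hx, e.apply_symm_apply x⟩

/-- Every `φ ∈ D_{K_0}` preserves `U_5^{(k)}`: `φ(U_5^{(k)}) = U_5^{(k)}`. -/
theorem DK0_preserves_U5 (n k : ℕ) (hn : 3 ≤ n) (hk : 1 ≤ k)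
    (φ : Equiv.Perm (ℕ → ℤ)) (hφ : φ ∈ DK0 n) :
    (φ : (ℕ → ℤ) → (ℕ → ℤ)) '' U5 n k = U5 n k := by
  induction hφ using Subgroup.closure_induction with
  | mem φ h =>
    rcases h with rfl | ⟨σ, h0, hσ, rfl⟩
    · exact image_eq_of_mapsTo_of_mapsTo_symm (mapsTo_cremona_U5 hn hk) (mapsTo_cremona_U5 hn hk)
    · exact image_eq_of_mapsTo_of_mapsTo_symm (mapsTo_permEquiv_U5 k h0 hσ)
        (mapsTo_permEquiv_U5 (σ := σ.symm) k (σ.symm_apply_eq.2 h0.symm)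
          fun i hi ↦ σ.symm_apply_eq.2 (hσ i hi).symm)
  | one => simp
  | mul φ ψ _ _ hφ hψ => rw [Equiv.Perm.coe_mul, Set.image_comp, hψ, hφ]
  | inv φ _ hφ =>
    conv_lhs => rw [← hφ]
    rw [← Set.image_comp, ← Equiv.Perm.coe_mul, inv_mul_cancel, Equiv.Perm.coe_one, Set.image_id]
end

section
/- Fix integers 3 ≤ n ≤ 8 and k ≥ 1. For every A ∈ U_5^{(k)}, the orbit { φ(A) : φ ∈ D_{K_0} } is a finite set. -/
/-- The canonical pairing `3a - ∑ b_i` of a class. -/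
def chernPairing (n : ℕ) (A : ℕ → ℤ) : ℤ := 3 * A 0 - ∑ i ∈ Finset.Icc 1 n, A i

/-- The self-intersection `a² - ∑ b_i²` of a class. -/
def selfIntersection (n : ℕ) (A : ℕ → ℤ) : ℤ := A 0 ^ 2 - ∑ i ∈ Finset.Icc 1 n, A i ^ 2

/-- Two classes share the canonical pairing, the self-intersection and the coordinates
beyond `n`. -/
def SameInvariants (n : ℕ) (A B : ℕ → ℤ) : Prop :=
  chernPairing n A = chernPairing n B ∧ selfIntersection n A = selfIntersection n B ∧
    ∀ i, n < i → A i = B i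

lemma sum_cremona (n : ℕ) (hn : 3 ≤ n) (f : ℤ → ℤ) (A : ℕ → ℤ) :
    ∑ i ∈ Finset.Icc 1 n, f (cremona A i) - ∑ i ∈ Finset.Icc 1 n, f (A i) =
      f (A 0 - A 2 - A 3) + f (A 0 - A 1 - A 3) + f (A 0 - A 1 - A 2)
        - (f (A 1) + f (A 2) + f (A 3)) := by
  induction n, hn using Nat.le_induction with
  | base => simp [Finset.sum_Icc_succ_top, cremona]
  | succ m hm ih =>
    rw [Finset.sum_Icc_succ_top (by omega), Finset.sum_Icc_succ_top (by omega)]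
    have h : cremona A (m + 1) = A (m + 1) := by
      simp [cremona, show m ≠ 0 by omega, show m ≠ 1 by omega, show m ≠ 2 by omega]
    rw [h, ← ih]
    ring

lemma sameInvariants_cremona (n : ℕ) (hn : 3 ≤ n) (A : ℕ → ℤ) :
    SameInvariants n (cremona A) A := by
  have h0 : cremona A 0 = 2 * A 0 - A 1 - A 2 - A 3 := rfl
  refine ⟨?_, ?_, fun i hi => ?_⟩
  · have h := sum_cremona n hn (fun x => x) A
    simp only [chernPairing, h0]
    linarith
  · have h := sum_cremona n hn (fun x => x ^ 2) A
    simp only [selfIntersection, h0]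
    linarith
  · simp [cremona, show i ≠ 0 by omega, show i ≠ 1 by omega, show i ≠ 2 by omega,
      show i ≠ 3 by omega]

lemma sameInvariants_permEquiv (n : ℕ) (σ : Equiv.Perm ℕ) (h0 : σ 0 = 0)
    (hσ : ∀ i, n < i → σ i = i) (A : ℕ → ℤ) : SameInvariants n (permEquiv σ A) A := by
  have happ : ∀ i, permEquiv σ A i = A (σ.symm i) := fun i => rfl
  have hs0 : σ.symm 0 = 0 := by rw [Equiv.symm_apply_eq, h0]
  have hs : ∀ i, n < i → σ.symm i = i := fun i hi => by rw [Equiv.symm_apply_eq, hσ i hi]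
  have hmem : ∀ i, i ∈ Finset.Icc 1 n ↔ σ.symm i ∈ Finset.Icc 1 n := by
    intro i
    have key : ∀ τ : Equiv.Perm ℕ, τ 0 = 0 → (∀ i, n < i → τ i = i) →
        ∀ i, i ∈ Finset.Icc 1 n → τ i ∈ Finset.Icc 1 n := by
      intro τ hτ0 hτ i hi
      rw [Finset.mem_Icc] at hi ⊢
      have h1 : τ i ≠ 0 := fun h => by
        have := τ.injective (h.trans hτ0.symm)
        omega
      have h2 : ¬ n < τ i := fun h => by
        have := τ.injective (hτ _ h)
        omega
      omega
    exact ⟨key σ.symm hs0 hs i, fun h => by simpa using key σ h0 hσ _ h⟩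
  have hsum : ∀ f : ℤ → ℤ, ∑ i ∈ Finset.Icc 1 n, f (permEquiv σ A i) =
      ∑ i ∈ Finset.Icc 1 n, f (A i) := fun f =>
    Finset.sum_equiv σ.symm hmem fun i _ => by rw [happ]
  refine ⟨?_, ?_, fun i hi => by rw [happ, hs i hi]⟩
  · simp only [chernPairing, happ 0, hs0, hsum fun x => x]
  · simp only [selfIntersection, happ 0, hs0, hsum fun x => x ^ 2]

lemma sameInvariants_of_mem_DK0 (n : ℕ) (hn : 3 ≤ n) {φ : Equiv.Perm (ℕ → ℤ)}
    (hφ : φ ∈ DK0 n) : ∀ A, SameInvariants n (φ A) A := by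
  induction hφ using Subgroup.closure_induction with
  | mem φ h =>
    rcases h with rfl | ⟨σ, h0, hσ, rfl⟩
    · exact sameInvariants_cremona n hn
    · exact sameInvariants_permEquiv n σ h0 hσ
  | one => exact fun A => ⟨rfl, rfl, fun _ _ => rfl⟩
  | mul φ ψ _ _ hφ hψ =>
    intro A
    obtain ⟨h1, h2, h3⟩ := hφ (ψ A)
    obtain ⟨g1, g2, g3⟩ := hψ A
    exact ⟨h1.trans g1, h2.trans g2, fun i hi => (h3 i hi).trans (g3 i hi)⟩
  | inv φ _ hφ =>
    intro A
    have h := hφ (φ⁻¹ A)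
    rw [show φ (φ⁻¹ A) = A from φ.apply_symm_apply A] at h
    exact ⟨h.1.symm, h.2.1.symm, fun i hi => (h.2.2 i hi).symm⟩

/-- For `n ≤ 8` the intersection form is negative definite on the orthogonal complement of the canonical
class, so the two invariants bound every coordinate. -/
lemma sq_le_of_invariants (n : ℕ) (hn : n ≤ 8) (A : ℕ → ℤ) (i : ℕ) (hi : i ≤ n) :
    A i ^ 2 ≤ 36 * chernPairing n A ^ 2 + 17 * |selfIntersection n A| := by
  have hCS : (∑ i ∈ Finset.Icc 1 n, A i) ^ 2 ≤ n * ∑ i ∈ Finset.Icc 1 n, A i ^ 2 := by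
    simpa using sq_sum_le_card_mul_sum_sq (s := Finset.Icc 1 n) (f := A)
  have hn' : (n : ℤ) ≤ 8 := by exact_mod_cast hn
  have hS : 0 ≤ ∑ i ∈ Finset.Icc 1 n, A i ^ 2 := Finset.sum_nonneg fun _ _ => sq_nonneg _
  have hb : i ≠ 0 → A i ^ 2 ≤ ∑ i ∈ Finset.Icc 1 n, A i ^ 2 := fun h0 =>
    Finset.single_le_sum (f := fun i => A i ^ 2) (fun _ _ => sq_nonneg _)
      (Finset.mem_Icc.2 ⟨by omega, hi⟩)
  simp only [chernPairing, selfIntersection]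
  generalize (∑ i ∈ Finset.Icc 1 n, A i) = s at *
  generalize (∑ i ∈ Finset.Icc 1 n, A i ^ 2) = S at *
  have h8 : s ^ 2 ≤ 8 * S := hCS.trans (mul_le_mul_of_nonneg_right hn' hS)
  have habs := neg_abs_le (A 0 ^ 2 - S)
  have hpos := abs_nonneg (A 0 ^ 2 - S)
  have ha : A 0 ^ 2 ≤ 36 * (3 * A 0 - s) ^ 2 + 16 * |A 0 ^ 2 - S| := by
    have := le_abs_self (A 0 ^ 2 - S)
    nlinarith [sq_nonneg (A 0 - 6 * (3 * A 0 - s)), sq_nonneg (3 * A 0 - s)]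
  rcases eq_or_ne i 0 with rfl | h0
  · linarith
  · linarith [hb h0]

lemma finite_bounded_support (n : ℕ) (M : ℤ) (A : ℕ → ℤ) :
    {B : ℕ → ℤ | (∀ i ≤ n, B i ^ 2 ≤ M) ∧ ∀ i, n < i → B i = A i}.Finite := by
  refine Set.Finite.of_finite_image (f := fun B (i : Fin (n + 1)) => B i) ?_ ?_
  · refine (Set.Finite.pi' fun _ : Fin (n + 1) => Set.finite_Icc (-M) M).subset ?_
    rintro _ ⟨B, ⟨hB, -⟩, rfl⟩ i
    have h := hB i (by omega)
    exact ⟨by nlinarith, by nlinarith [Int.le_self_sq (B i)]⟩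
  · intro B hB C hC h
    funext i
    by_cases hi : i ≤ n
    · exact congrFun h ⟨i, by omega⟩
    · rw [hB.2 i (by omega), hC.2 i (by omega)]

/-- For `3 ≤ n ≤ 8`, the `D_{K_0}`-orbit of any class `A ∈ U_5^{(k)}` is finite. -/
theorem DK0_orbit_finite (n k : ℕ) (hn3 : 3 ≤ n) (hn8 : n ≤ 8) (hk : 1 ≤ k)
    (A : ℕ → ℤ) (hA : A ∈ U5 n k) :
    Set.Finite {B : ℕ → ℤ | ∃ φ ∈ DK0 n, B = φ A} := by
  refine (finite_bounded_support n
    (36 * chernPairing n A ^ 2 + 17 * |selfIntersection n A|) A).subset ?_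
  rintro _ ⟨φ, hφ, rfl⟩
  obtain ⟨h1, h2, h3⟩ := sameInvariants_of_mem_DK0 n hn3 hφ A
  exact ⟨fun i hi => h1 ▸ h2 ▸ sq_le_of_invariants n hn8 (φ A) i hi, h3⟩
end

section
/- Fix integers n ≥ 1 and k ≥ 1. Every chain in (U_5^{(k)}, ≥) stabilizes: for any sequence A_1, A_2, A_3, ... of elements of U_5^{(k)} with A_i ≥ A_{i+1} for all i, there exists N such that A_i = A_N for all i ≥ N. -/
/-- The partial order on `U_5^{(k)}`: `A ≥ B` iff `ω_x(A) ≥ ω_x(B)` for all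
`x` in the `c_1`-nef cone. -/
def geCl (n : ℕ) (A B : ℕ → ℤ) : Prop :=
  ∀ x ∈ c1Nef n, omegaEval n x B ≤ omegaEval n x A

/-- The vector `(L, 2, …, 2, 1, …, 1)` whose entries in positions `1, …, p` are `2`. -/
noncomputable def stepVec (L : ℝ) (p : ℕ) : ℕ → ℝ :=
  fun j => if j = 0 then L else if j ≤ p then 2 else 1

lemma stepVec_zero (L : ℝ) (p : ℕ) : stepVec L p 0 = L := by simp [stepVec]

lemma stepVec_of_pos (L : ℝ) (p : ℕ) {j : ℕ} (hj : 1 ≤ j) :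
    stepVec L p j = if j ≤ p then 2 else 1 := by
  simp [stepVec, Nat.one_le_iff_ne_zero.mp hj]

lemma stepVec_pos_le_two (L : ℝ) (p : ℕ) {j : ℕ} (hj : 1 ≤ j) :
    0 < stepVec L p j ∧ stepVec L p j ≤ 2 := by
  rw [stepVec_of_pos L p hj]
  split_ifs <;> norm_num

lemma stepVec_anti (L : ℝ) (p : ℕ) {i j : ℕ} (hi : 1 ≤ i) (hij : i ≤ j) :
    stepVec L p j ≤ stepVec L p i := by
  rw [stepVec_of_pos L p hi, stepVec_of_pos L p (hi.trans hij)]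
  split_ifs <;> first | omega | norm_num

lemma stepVec_mem_c1Nef {n : ℕ} (hn : 1 ≤ n) {L : ℝ} (hL : 4 * (n : ℝ) + 4 ≤ L) (p : ℕ) :
    stepVec L p ∈ c1Nef n := by
  have hn' : (1 : ℝ) ≤ n := by exact_mod_cast hn
  have hb := fun j (hj : 1 ≤ j) => stepVec_pos_le_two L p hj
  have hsum : ∑ i ∈ Finset.Icc 1 n, stepVec L p i ≤ 2 * n := by
    calc _ ≤ ∑ i ∈ Finset.Icc 1 n, (2 : ℝ) :=
          Finset.sum_le_sum fun i hi => (hb i (Finset.mem_Icc.mp hi).1).2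
      _ = 2 * n := by simp [mul_comm]
  have hsq : ∑ i ∈ Finset.Icc 1 n, (stepVec L p i) ^ 2 ≤ 4 * n := by
    calc _ ≤ ∑ i ∈ Finset.Icc 1 n, (4 : ℝ) := Finset.sum_le_sum fun i hi => by
          have := hb i (Finset.mem_Icc.mp hi).1
          nlinarith
      _ = 4 * n := by simp [mul_comm]
  have h1 := hb 1 le_rfl
  have h2 := hb 2 (by norm_num)
  have h3 := hb 3 (by norm_num)
  refine ⟨by rw [stepVec_zero]; linarith, ?_⟩
  split_ifs
  · exact ⟨h1.1, by rw [stepVec_zero]; linarith⟩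
  · exact ⟨h2.1, stepVec_anti L p le_rfl (by norm_num), by rw [stepVec_zero]; linarith⟩
  · refine ⟨(hb n hn).1, fun i j hi hij _ => stepVec_anti L p hi hij, ?_, ?_⟩
    · rw [stepVec_zero]; linarith
    · rw [stepVec_zero]; nlinarith

lemma omegaEval_stepVec_succ_sub {n p : ℕ} (hp : p + 1 ≤ n) (L : ℝ) (A : ℕ → ℤ) :
    omegaEval n (stepVec L p) A - omegaEval n (stepVec L (p + 1)) A = A (p + 1) := by
  have h : ∀ i ∈ Finset.Icc 1 n, (A i : ℝ) * stepVec L (p + 1) i - A i * stepVec L p i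
      = if i = p + 1 then (A (p + 1) : ℝ) else 0 := fun i hi => by
    have hi := (Finset.mem_Icc.mp hi).1
    rw [stepVec_of_pos L _ hi, stepVec_of_pos L _ hi]
    rcases lt_trichotomy i (p + 1) with h | h | h
    · rw [if_pos (by omega), if_pos (by omega), if_neg (by omega), sub_self]
    · subst h
      rw [if_pos le_rfl, if_neg (by omega), if_pos rfl]
      ring
    · rw [if_neg (by omega), if_neg (by omega), if_neg (by omega), sub_self]
  have hs := Finset.sum_congr rfl h
  rw [Finset.sum_sub_distrib, Finset.sum_ite_eq' (Finset.Icc 1 n) (p + 1),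
    if_pos (Finset.mem_Icc.mpr ⟨by omega, hp⟩)] at hs
  simp only [omegaEval, stepVec_zero]
  linarith

lemma geCl_trans {n : ℕ} {A B C : ℕ → ℤ} (hAB : geCl n A B) (hBC : geCl n B C) : geCl n A C :=
  fun x hx => (hBC x hx).trans (hAB x hx)

lemma geCl_antisymm {n : ℕ} (hn : 1 ≤ n) {A B : ℕ → ℤ} (hA : ∀ i, n < i → A i = 0)
    (hB : ∀ i, n < i → B i = 0) (hAB : geCl n A B) (hBA : geCl n B A) : A = B := by
  set L : ℝ := 4 * (n : ℝ) + 4 with hL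
  have heq : ∀ p, omegaEval n (stepVec L p) A = omegaEval n (stepVec L p) B := fun p =>
    have hm := stepVec_mem_c1Nef hn le_rfl p
    le_antisymm (hBA _ hm) (hAB _ hm)
  have hpos : ∀ j, 1 ≤ j → A j = B j := fun j hj => by
    obtain ⟨p, rfl⟩ : ∃ p, j = p + 1 := ⟨j - 1, by omega⟩
    rcases Nat.lt_or_ge n (p + 1) with h | h
    · rw [hA _ h, hB _ h]
    · have h1 := omegaEval_stepVec_succ_sub h L A
      rw [heq, heq, omegaEval_stepVec_succ_sub h L B] at h1
      exact_mod_cast h1.symm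
  funext j
  rcases Nat.eq_zero_or_pos j with rfl | hj
  · have h0 := heq 0
    have hs : ∑ i ∈ Finset.Icc 1 n, (A i : ℝ) * stepVec L 0 i
        = ∑ i ∈ Finset.Icc 1 n, (B i : ℝ) * stepVec L 0 i :=
      Finset.sum_congr rfl fun i hi => by rw [hpos i (Finset.mem_Icc.mp hi).1]
    simp only [omegaEval, hs, stepVec_zero, sub_left_inj] at h0
    exact_mod_cast mul_right_cancel₀ (by positivity) h0
  · exact hpos j hj

/-- The ray of `(1, 0, …, 0)` lies in the closure of the `c_1`-nef cone, so the order controls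
the coefficient of `H`. -/
lemma geCl.apply_zero_le {n : ℕ} (hn : 1 ≤ n) {A B : ℕ → ℤ} (h : geCl n A B) : B 0 ≤ A 0 := by
  by_contra! hlt
  set s := ∑ i ∈ Finset.Icc 1 n, (A i : ℝ)
  set t := ∑ i ∈ Finset.Icc 1 n, (B i : ℝ)
  set L : ℝ := 4 * (n : ℝ) + 4 + |t - s| with hL
  have hm := h _ (stepVec_mem_c1Nef hn (L := L) (by rw [hL]; linarith [abs_nonneg (t - s)]) 0)
  have hω : ∀ C : ℕ → ℤ, omegaEval n (stepVec L 0) C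
      = C 0 * L - ∑ i ∈ Finset.Icc 1 n, (C i : ℝ) := fun C => by
    rw [omegaEval, stepVec_zero]
    congr 1
    refine Finset.sum_congr rfl fun i hi => ?_
    have hi := (Finset.mem_Icc.mp hi).1
    rw [stepVec_of_pos L 0 hi, if_neg (by omega), mul_one]
  rw [hω, hω] at hm
  have h1 : (A 0 : ℝ) + 1 ≤ B 0 := by exact_mod_cast hlt
  have h2 : t - s < L := by
    have : (0 : ℝ) ≤ n := n.cast_nonneg
    linarith [le_abs_self (t - s)]
  have h3 : 0 ≤ L := by positivity
  nlinarith

/-- There are only finitely many classes in `U_5^{(k)}` with a given coefficient of `H`. -/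
lemma finite_U5_apply_zero_eq (n k : ℕ) (a : ℤ) : {A ∈ U5 n k | A 0 = a}.Finite := by
  set M : ℤ := a ^ 2 + 3 * a with hM
  set c : Fin (n + 1) → ℤ := fun _ => |M| + |a| + 1 with hc
  let e : (Fin (n + 1) → ℤ) → ℕ → ℤ := fun f j => if h : j < n + 1 then f ⟨j, h⟩ else 0
  refine ((Set.finite_Icc (-c) c).image e).subset ?_
  rintro A ⟨⟨_, hind, hsupp⟩, rfl⟩
  have hnn : ∀ b : ℤ, 0 ≤ b ^ 2 + b := fun b => by
    rcases le_or_gt 0 b with h | h <;> nlinarith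
  have hbound : ∀ j ≤ n, |A j| ≤ |M| + |A 0| + 1 := fun j hj => by
    rcases Nat.eq_zero_or_pos j with rfl | hj0
    · linarith [abs_nonneg M]
    · have h1 : A j ^ 2 + A j ≤ ∑ i ∈ Finset.Icc 1 n, ((A i) ^ 2 + A i) :=
        Finset.single_le_sum (f := fun i => (A i) ^ 2 + A i) (fun i _ => hnn (A i))
          (Finset.mem_Icc.mpr ⟨hj0, hj⟩)
      have h2 : A j ^ 2 + A j ≤ |M| := by
        have := le_abs_self M
        unfold indCl at hind
        have : (0 : ℤ) ≤ k := by positivity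
        linarith
      have h3 := abs_nonneg (A 0)
      rw [abs_le]
      constructor <;> nlinarith [sq_nonneg (A j + 1), sq_nonneg (A j)]
  refine ⟨fun i => A i, ?_, ?_⟩
  · rw [Set.mem_Icc, Pi.le_def, Pi.le_def]
    exact ⟨fun i => (abs_le.mp (hbound i (by omega))).1,
      fun i => (abs_le.mp (hbound i (by omega))).2⟩
  · funext j
    simp only [e]
    split_ifs
    · rfl
    · exact (hsupp j (by omega)).symm

/-- An antitone sequence of positive integers is eventually constant. -/
lemma Antitone.exists_eventually_eq_of_pos {f : ℕ → ℤ} (hf : Antitone f) (hpos : ∀ i, 0 < f i) :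
    ∃ N, ∀ i, N ≤ i → f i = f N := by
  obtain ⟨_, ⟨N, rfl⟩, hN⟩ := wellFounded_lt.has_min (Set.range fun i => (f i).toNat) ⟨_, 0, rfl⟩
  refine ⟨N, fun i hi => (hf hi).antisymm ?_⟩
  have h : ¬ (f i).toNat < (f N).toNat := hN _ ⟨i, rfl⟩
  have := hpos i
  have := hpos N
  omega

/-- Every chain `A_1 ≥ A_2 ≥ ⋯` in `(U_5^{(k)}, ≥)` stabilizes. -/
theorem chain_stabilizes (n k : ℕ) (hn : 1 ≤ n) (hk : 1 ≤ k)
    (A : ℕ → (ℕ → ℤ)) (hmem : ∀ i, A i ∈ U5 n k)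
    (hchain : ∀ i, geCl n (A i) (A (i + 1))) :
    ∃ N, ∀ i, N ≤ i → A i = A N := by
  have hle : ∀ i j, i ≤ j → geCl n (A i) (A j) := fun i j hij => by
    induction j, hij using Nat.le_induction with
    | base => exact fun _ _ => le_rfl
    | succ j _ ih => exact geCl_trans ih (hchain j)
  obtain ⟨N, hN⟩ := Antitone.exists_eventually_eq_of_pos (f := fun i => A i 0)
    (fun i j hij => (hle i j hij).apply_zero_le hn) fun i => (hmem i).1
  have := (finite_U5_apply_zero_eq n k (A N 0)).to_subtype
  obtain ⟨v, hv⟩ := Finite.exists_infinite_fiber fun i : ℕ =>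
    (⟨A (N + i), hmem _, hN _ (Nat.le_add_right N i)⟩ : {B ∈ U5 n k | B 0 = A N 0})
  rw [Set.infinite_coe_iff] at hv
  have hfiber : ∀ i, ∃ m, i < m ∧ A (N + m) = v := fun i => by
    obtain ⟨m, hm, him⟩ := hv.exists_gt i
    exact ⟨m, him, congrArg Subtype.val hm⟩
  obtain ⟨m, -, hm⟩ := hfiber 0
  refine ⟨N + m, fun i hi => ?_⟩
  obtain ⟨l, hl, hlv⟩ := hfiber i
  refine geCl_antisymm hn (hmem i).2.2 (hmem _).2.2 ?_ (hle _ _ hi)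
  rw [hm, ← hlv]
  exact hle _ _ (by omega)
end

section
/- Fix integers n ≥ 3 and k ≥ 1. Every minimal element A = aH − Σ_{i=1}^n b_iE_i of (U_5^{(k)}, ≥) is reduced (that is, a > 0, b_1 ≥ b_2 ≥ ... ≥ b_n ≥ 0 and a ≥ b_1 + b_2 + b_3) and satisfies 3a − Σ_{i=1}^n b_i ≥ 1. -/
/-- `A` is a minimal element of `(U_5^{(k)}, ≥)`. -/
def MinimalU5 (n k : ℕ) (A : ℕ → ℤ) : Prop :=
  A ∈ U5 n k ∧ ∀ B ∈ U5 n k, B ≠ A → ¬ geCl n A B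

section

open Finset

/-- Sums of functions agreeing off a subset differ by the sum of the differences there. -/
theorem sum_sub_sum_of_eq_off {R : Type*} [AddCommGroup R] {s t : Finset ℕ} (h : s ⊆ t)
    {f g : ℕ → R} (hfg : ∀ i ∈ t, i ∉ s → f i = g i) :
    ∑ i ∈ t, f i - ∑ i ∈ t, g i = ∑ i ∈ s, (f i - g i) := by
  rw [← sum_sub_distrib]
  exact (sum_subset h fun i hi hs => sub_eq_zero.2 (hfg i hi hs)).symm

theorem mem_c1Nef_iff {n : ℕ} (hn : 3 ≤ n) {x : ℕ → ℝ} :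
    x ∈ c1Nef n ↔ 0 < 3 * x 0 - ∑ i ∈ Icc 1 n, x i ∧ 0 < x n ∧
      (∀ i j, 1 ≤ i → i ≤ j → j ≤ n → x j ≤ x i) ∧
      x 1 + x 2 + x 3 ≤ x 0 ∧ ∑ i ∈ Icc 1 n, (x i) ^ 2 < (x 0) ^ 2 := by
  simp only [c1Nef, Set.mem_ofPred_eq, if_neg (show n ≠ 1 by lia), if_neg (show n ≠ 2 by lia)]

/-- A minimal class dominates no other class of at least the same index. -/
theorem MinimalU5.eq_of_geCl {n k : ℕ} {A B : ℕ → ℤ} (hA : MinimalU5 n k A)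
    (hpos : 0 < B 0) (hind : indCl n A ≤ indCl n B) (hsupp : ∀ i, n < i → B i = 0)
    (hge : geCl n A B) : B = A := by
  by_contra hne
  exact hA.2 B ⟨hpos, hA.1.2.1.trans hind, hsupp⟩ hne hge

theorem MinimalU5.antitone {n k : ℕ} (hn : 3 ≤ n) {A : ℕ → ℤ} (hA : MinimalU5 n k A)
    {i j : ℕ} (hi : 1 ≤ i) (hij : i ≤ j) (hj : j ≤ n) : A j ≤ A i := by
  by_contra! hlt
  have hne : i ≠ j := by rintro rfl; exact lt_irrefl _ hlt
  set B : ℕ → ℤ := fun l => if l = i then A j else if l = j then A i else A l with hB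
  have hBi : B i = A j := by simp [hB]
  have hBj : B j = A i := by simp [hB, hne.symm]
  have hBl : ∀ l, l ≠ i → l ≠ j → B l = A l := fun l h h' => by simp [hB, h, h']
  have hB0 : B 0 = A 0 := hBl 0 (by lia) (by lia)
  have hsub : ({i, j} : Finset ℕ) ⊆ Icc 1 n := by
    intro l hl
    simp only [mem_insert, mem_singleton] at hl
    rw [mem_Icc]
    lia
  have hoff : ∀ l, l ∉ ({i, j} : Finset ℕ) → B l = A l := fun l hl => by
    simp only [mem_insert, mem_singleton, not_or] at hl
    exact hBl l hl.1 hl.2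
  have hBA : B = A := by
    refine hA.eq_of_geCl (hB0 ▸ hA.1.1) ?_ (fun l hl => ?_) fun x hx => ?_
    · have := sum_sub_sum_of_eq_off hsub (f := fun l => A l ^ 2 + A l)
        (g := fun l => B l ^ 2 + B l) fun l _ hl => by simp only [hoff l hl]
      rw [sum_pair hne, hBi, hBj] at this
      simp only [indCl, hB0]
      linarith
    · rw [hBl l (by lia) (by lia)]
      exact hA.1.2.2 l hl
    · have := sum_sub_sum_of_eq_off hsub (f := fun l => (A l : ℝ) * x l)
        (g := fun l => (B l : ℝ) * x l) fun l _ hl => by simp only [hoff l hl]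
      rw [sum_pair hne, hBi, hBj] at this
      have hx' := ((mem_c1Nef_iff hn).1 hx).2.2.1 i j hi hij hj
      have hlt' : (A i : ℝ) < A j := by exact_mod_cast hlt
      simp only [omegaEval, hB0]
      nlinarith [mul_nonneg (sub_nonneg.2 hx') (sub_nonneg.2 hlt'.le)]
  rw [hBA] at hBi
  lia

theorem MinimalU5.nonneg {n k : ℕ} (hn : 3 ≤ n) {A : ℕ → ℤ} (hA : MinimalU5 n k A)
    {i : ℕ} (hi : 1 ≤ i) (hin : i ≤ n) : 0 ≤ A i := by
  by_contra! hlt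
  set B : ℕ → ℤ := fun l => if l = i then -1 - A i else A l with hB
  have hBi : B i = -1 - A i := by simp [hB]
  have hBl : ∀ l, l ≠ i → B l = A l := fun l h => by simp [hB, h]
  have hB0 : B 0 = A 0 := hBl 0 (by lia)
  have hsub : ({i} : Finset ℕ) ⊆ Icc 1 n := by simp [hi, hin]
  have hoff : ∀ l, l ∉ ({i} : Finset ℕ) → B l = A l := fun l hl => hBl l (by simpa using hl)
  have hBA : B = A := by
    refine hA.eq_of_geCl (hB0 ▸ hA.1.1) ?_ (fun l hl => ?_) fun x hx => ?_
    · have := sum_sub_sum_of_eq_off hsub (f := fun l => A l ^ 2 + A l)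
        (g := fun l => B l ^ 2 + B l) fun l _ hl => by simp only [hoff l hl]
      rw [sum_singleton, hBi] at this
      simp only [indCl, hB0]
      linarith
    · rw [hBl l (by lia)]
      exact hA.1.2.2 l hl
    · have := sum_sub_sum_of_eq_off hsub (f := fun l => (A l : ℝ) * x l)
        (g := fun l => (B l : ℝ) * x l) fun l _ hl => by simp only [hoff l hl]
      rw [sum_singleton, hBi] at this
      push_cast at this
      have hx' := (mem_c1Nef_iff hn).1 hx
      have hxi : 0 < x i := hx'.2.1.trans_le (hx'.2.2.1 i n hi hin le_rfl)
      have hlt' : (A i : ℝ) ≤ -1 := by exact_mod_cast (by lia : A i ≤ -1)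
      simp only [omegaEval, hB0]
      nlinarith [mul_nonneg hxi.le (by linarith : (0 : ℝ) ≤ -1 - A i)]
  rw [hBA] at hBi
  lia

theorem MinimalU5.add_add_le {n k : ℕ} (hn : 3 ≤ n) (hk : 1 ≤ k) {A : ℕ → ℤ}
    (hA : MinimalU5 n k A) : A 1 + A 2 + A 3 ≤ A 0 := by
  by_contra! hlt
  have hsub : ({1, 2, 3} : Finset ℕ) ⊆ Icc 1 n := by
    intro l hl
    simp only [mem_insert, mem_singleton] at hl
    rw [mem_Icc]
    lia
  have hsum (f : ℕ → ℤ) : ∑ l ∈ ({1, 2, 3} : Finset ℕ), f l = f 1 + f 2 + f 3 := by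
    simp [add_assoc]
  have hsumR (f : ℕ → ℝ) : ∑ l ∈ ({1, 2, 3} : Finset ℕ), f l = f 1 + f 2 + f 3 := by
    simp [add_assoc]
  have h0 := hA.1.1
  have hA0 : 2 ≤ A 0 := by
    by_contra! h
    have h1 : A 0 = 1 := by lia
    have hind := hA.1.2.1
    have hle := sum_le_sum_of_subset_of_nonneg hsub (f := fun l => A l ^ 2 + A l)
      fun l hl _ => by
        have := hA.nonneg hn (mem_Icc.1 hl).1 (mem_Icc.1 hl).2
        positivity
    rw [hsum] at hle
    simp only [indCl, h1] at hind
    have hk' : (1 : ℤ) ≤ k := by exact_mod_cast hk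
    nlinarith [sq_nonneg (A 1 - 1), sq_nonneg (A 2 - 1), sq_nonneg (A 3 - 1),
      Int.le_self_sq (A 1), Int.le_self_sq (A 2), Int.le_self_sq (A 3)]
  set B : ℕ → ℤ := fun l => if l ≤ 3 then A l - 1 else A l with hB
  have hBs : ∀ l, l ≤ 3 → B l = A l - 1 := fun l h => by simp [hB, h]
  have hoff : ∀ l ∈ Icc 1 n, l ∉ ({1, 2, 3} : Finset ℕ) → B l = A l := fun l hl hl' => by
    rw [mem_Icc] at hl
    simp only [mem_insert, mem_singleton, not_or] at hl'
    exact if_neg (by lia)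
  have hBA : B = A := by
    refine hA.eq_of_geCl ?_ ?_ (fun l hl => ?_) fun x hx => ?_
    · rw [hBs 0 (by lia)]; lia
    · have := sum_sub_sum_of_eq_off hsub (f := fun l => A l ^ 2 + A l)
        (g := fun l => B l ^ 2 + B l) fun l hl hl' => by simp only [hoff l hl hl']
      rw [hsum, hBs 1 (by lia), hBs 2 (by lia), hBs 3 (by lia)] at this
      simp only [indCl, hBs 0 (by lia)]
      linarith
    · exact (if_neg (by lia)).trans (hA.1.2.2 l hl)
    · have := sum_sub_sum_of_eq_off hsub (f := fun l => (A l : ℝ) * x l)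
        (g := fun l => (B l : ℝ) * x l) fun l hl hl' => by simp only [hoff l hl hl']
      rw [hsumR, hBs 1 (by lia), hBs 2 (by lia), hBs 3 (by lia)] at this
      push_cast at this
      have hx' := ((mem_c1Nef_iff hn).1 hx).2.2.2.1
      simp only [omegaEval, hBs 0 (by lia)]
      push_cast
      linarith
  have := hBs 0 (by lia)
  rw [hBA] at this
  lia

/-- A minimal class pairs positively with `c_1`: otherwise subtracting the Poincaré dual
of `c_1` would give a smaller class. -/
theorem MinimalU5.one_le_c1 {n k : ℕ} (hn : 3 ≤ n) (hk : 1 ≤ k) {A : ℕ → ℤ}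
    (hA : MinimalU5 n k A) : 1 ≤ 3 * A 0 - ∑ i ∈ Icc 1 n, A i := by
  by_contra! hlt
  have h0 := hA.1.1
  have hA0 : 4 ≤ A 0 := by
    have hind := hA.1.2.1
    have hle : ∑ i ∈ Icc 1 n, A i ≤ ∑ i ∈ Icc 1 n, A i ^ 2 :=
      sum_le_sum fun i _ => Int.le_self_sq (A i)
    simp only [indCl, sum_add_distrib] at hind
    have hk' : (1 : ℤ) ≤ k := by exact_mod_cast hk
    by_contra! h
    nlinarith
  set B : ℕ → ℤ := fun l => if l = 0 then A l - 3 else if l ≤ n then A l - 1 else A l with hB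
  have hB0 : B 0 = A 0 - 3 := by simp [hB]
  have hBl : ∀ l ∈ Icc 1 n, B l = A l - 1 := fun l hl => by
    rw [mem_Icc] at hl
    simp [hB, hl.2, (show l ≠ 0 by lia)]
  have hBA : B = A := by
    refine hA.eq_of_geCl ?_ ?_ (fun l hl => ?_) fun x hx => ?_
    · rw [hB0]; lia
    · have : ∑ l ∈ Icc 1 n, (B l ^ 2 + B l) =
          ∑ l ∈ Icc 1 n, (A l ^ 2 + A l) - 2 * ∑ l ∈ Icc 1 n, A l := by
        rw [mul_sum, ← sum_sub_distrib]
        exact sum_congr rfl fun l hl => by rw [hBl l hl]; ring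
      simp only [indCl, hB0, this]
      linarith
    · have : B l = A l := by simp [hB, (show l ≠ 0 by lia), (show ¬ l ≤ n by lia)]
      rw [this]
      exact hA.1.2.2 l hl
    · have : ∑ l ∈ Icc 1 n, (B l : ℝ) * x l =
          ∑ l ∈ Icc 1 n, (A l : ℝ) * x l - ∑ l ∈ Icc 1 n, x l := by
        rw [← sum_sub_distrib]
        exact sum_congr rfl fun l hl => by rw [hBl l hl]; push_cast; ring
      have hx' := hx.1
      simp only [omegaEval, hB0, this]
      push_cast
      linarith
  rw [hBA] at hB0
  lia

end

/-- Every minimal element `A = aH - ∑ b_i E_i` of `(U_5^{(k)}, ≥)` is reduced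
(`a > 0`, `b_1 ≥ b_2 ≥ ⋯ ≥ b_n ≥ 0`, `a ≥ b_1 + b_2 + b_3`) and satisfies
`3a - ∑ b_i ≥ 1`. -/
theorem minimal_is_reduced (n k : ℕ) (hn : 3 ≤ n) (hk : 1 ≤ k)
    (A : ℕ → ℤ) (hA : MinimalU5 n k A) :
    0 < A 0 ∧ (∀ i j, 1 ≤ i → i ≤ j → j ≤ n → A j ≤ A i) ∧ 0 ≤ A n ∧
      A 1 + A 2 + A 3 ≤ A 0 ∧ 1 ≤ 3 * A 0 - ∑ i ∈ Finset.Icc 1 n, A i := by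
  exact
    ⟨hA.1.1, fun _ _ hi hij hj => hA.antitone hn hi hij hj, hA.nonneg hn (by lia) le_rfl,
      hA.add_add_le hn hk, hA.one_le_c1 hn hk⟩
end

section
/- Fix integers n ≥ 3 and k ≥ 1. There exist real constants A_{n,k} and C_{n,k} with the following property: every reduced class A = aH − Σ_{i=1}^n b_iE_i ∈ U_5^{(k)} satisfying a > A_{n,k}, 3a − Σ_{i=1}^{min(n,9)} b_i > C_{n,k} and 3a − Σ_{i=1}^n b_i ≥ 1 satisfies A ≥ kH − kE_1, i.e. ω_x(A) ≥ ω_x(kH − kE_1) for all x ∈ P^{c_1>0}. In particular such a class A is not minimal. -/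
/-- A class `A = aH - ∑ b_i E_i` is reduced if `a > 0`,
`b_1 ≥ b_2 ≥ ⋯ ≥ b_n ≥ 0` and `a ≥ b_1 + b_2 + b_3`. -/
def ReducedCl (n : ℕ) (A : ℕ → ℤ) : Prop :=
  0 < A 0 ∧ (∀ i j, 1 ≤ i → i ≤ j → j ≤ n → A j ≤ A i) ∧ 0 ≤ A n ∧
    A 1 + A 2 + A 3 ≤ A 0

/-- The class `kH - kE_1`. -/
def kHkE1 (k : ℕ) : ℕ → ℤ := fun i => if i = 0 then (k : ℤ) else if i = 1 then (k : ℤ) else 0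

/-- The pairing inequality on the first ten coordinates: both vectors are reduced, and `b` pairs
well with the generators `H`, `H - E₁`, `2H - E₁ - E₂` and `3H - E₁ - ⋯ - Eₘ` of the cone of
reduced vectors. -/
lemma pairing_ge_of_reduced_nine {k : ℝ} (hk : 0 ≤ k) {b x : ℕ → ℝ}
    (hb0 : ∀ i, 1 ≤ i → 0 ≤ b i)
    (hbr : b 1 + b 2 + b 3 ≤ b 0) (hba : 9 * k ≤ b 0) (hb1 : 4 * k ≤ b 0 - b 1)
    (hbC : 14 * k ≤ 3 * b 0 - (b 1 + b 2 + b 3 + b 4 + b 5 + b 6 + b 7 + b 8 + b 9))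
    (hx : ∀ i, 1 ≤ i → i < 9 → x (i + 1) ≤ x i) (hx9 : 0 ≤ x 9)
    (hxr : x 1 + x 2 + x 3 ≤ x 0) :
    k * (x 0 - x 1)
        + 2 * k * (3 * x 0 - (x 1 + x 2 + x 3 + x 4 + x 5 + x 6 + x 7 + x 8 + x 9)) ≤
      b 0 * x 0 - (b 1 * x 1 + b 2 * x 2 + b 3 * x 3 + b 4 * x 4 + b 5 * x 5 + b 6 * x 6
        + b 7 * x 7 + b 8 * x 8 + b 9 * x 9) := by
  have h3 := hb0 3 (by norm_num)
  have h4 := hb0 4 (by norm_num)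
  have h5 := hb0 5 (by norm_num)
  have h6 := hb0 6 (by norm_num)
  have h7 := hb0 7 (by norm_num)
  have h8 := hb0 8 (by norm_num)
  have h9 := hb0 9 (by norm_num)
  have step := fun i (hi : 1 ≤ i) (hi' : i < 9) => sub_nonneg.2 (hx i hi hi')
  have g0 := mul_nonneg (sub_nonneg.2 hxr) (show 0 ≤ b 0 - 7 * k by linarith)
  have g1 := mul_nonneg (step 1 (by norm_num) (by norm_num)) (sub_nonneg.2 hb1)
  have g2 := mul_nonneg (step 2 (by norm_num) (by norm_num))
    (show 0 ≤ 2 * b 0 - b 1 - b 2 - 9 * k by linarith)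
  have g3 := mul_nonneg (step 3 (by norm_num) (by norm_num))
    (show 0 ≤ 3 * b 0 - (b 1 + b 2 + b 3) - 14 * k by linarith)
  have g4 := mul_nonneg (step 4 (by norm_num) (by norm_num))
    (show 0 ≤ 3 * b 0 - (b 1 + b 2 + b 3 + b 4) - 12 * k by linarith)
  have g5 := mul_nonneg (step 5 (by norm_num) (by norm_num))
    (show 0 ≤ 3 * b 0 - (b 1 + b 2 + b 3 + b 4 + b 5) - 10 * k by linarith)
  have g6 := mul_nonneg (step 6 (by norm_num) (by norm_num))
    (show 0 ≤ 3 * b 0 - (b 1 + b 2 + b 3 + b 4 + b 5 + b 6) - 8 * k by linarith)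
  have g7 := mul_nonneg (step 7 (by norm_num) (by norm_num))
    (show 0 ≤ 3 * b 0 - (b 1 + b 2 + b 3 + b 4 + b 5 + b 6 + b 7) - 6 * k by linarith)
  have g8 := mul_nonneg (step 8 (by norm_num) (by norm_num))
    (show 0 ≤ 3 * b 0 - (b 1 + b 2 + b 3 + b 4 + b 5 + b 6 + b 7 + b 8) - 4 * k by linarith)
  have g9 := mul_nonneg hx9
    (show 0 ≤ 3 * b 0 - (b 1 + b 2 + b 3 + b 4 + b 5 + b 6 + b 7 + b 8 + b 9) - 2 * k by linarith)
  norm_num at g0 g1 g2 g3 g4 g5 g6 g7 g8 g9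
  linarith

lemma sum_Icc_one_nine (f : ℕ → ℝ) :
    ∑ i ∈ Finset.Icc 1 9, f i = f 1 + f 2 + f 3 + f 4 + f 5 + f 6 + f 7 + f 8 + f 9 := by
  have h : Finset.Icc 1 9 = {1, 2, 3, 4, 5, 6, 7, 8, 9} := by decide
  rw [h]
  simp [add_assoc]

lemma sum_Icc_one_split (f : ℕ → ℝ) {N : ℕ} (hN : 10 ≤ N) :
    ∑ i ∈ Finset.Icc 1 N, f i = ∑ i ∈ Finset.Icc 1 9, f i + ∑ i ∈ Finset.Icc 10 N, f i := by
  have hunion : Finset.Icc 1 N = Finset.Icc 1 9 ∪ Finset.Icc 10 N := by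
    ext i
    simp only [Finset.mem_union, Finset.mem_Icc]
    omega
  rw [hunion, Finset.sum_union]
  rw [Finset.disjoint_left]
  intro i
  simp only [Finset.mem_Icc]
  omega

/-- If `b₀ - b₁` is small, all `bᵢ` with `i ≥ 2` are bounded and `b₀` dominates. -/
lemma pairing_ge_of_sub_le {N : ℕ} {k : ℝ} (hk : 0 ≤ k) {b x : ℕ → ℝ}
    (hb : ∀ i j, 1 ≤ i → i ≤ j → b j ≤ b i) (hb0 : ∀ i, 1 ≤ i → 0 ≤ b i)
    (hbr : b 1 + b 2 + b 3 ≤ b 0) (hba : 9 * k + 4 * k * N ≤ b 0) (hb1 : b 0 - b 1 ≤ 4 * k)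
    (hx : ∀ i j, 1 ≤ i → i ≤ j → x j ≤ x i) (hx0 : ∀ i, 1 ≤ i → 0 ≤ x i)
    (hxr : x 1 + x 2 + x 3 ≤ x 0) (hN : 1 ≤ N) :
    k * (x 0 - x 1) ≤ b 0 * x 0 - ∑ i ∈ Finset.Icc 1 N, b i * x i := by
  have hx1 := hx0 1 le_rfl
  have hx3 := hx0 3 (by norm_num)
  have hb2 := hb0 2 (by norm_num)
  have hb3 := hb0 3 (by norm_num)
  have hx2 := hx0 2 (by norm_num)
  have hsum : ∑ i ∈ Finset.Icc 2 N, b i * x i ≤ N * (4 * k * (x 0 - x 1)) := by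
    calc ∑ i ∈ Finset.Icc 2 N, b i * x i
        ≤ ∑ i ∈ Finset.Icc 2 N, 4 * k * (x 0 - x 1) := by
          refine Finset.sum_le_sum fun i hi => ?_
          have hi := (Finset.mem_Icc.1 hi).1
          have := hb 2 i (by norm_num) hi
          have := hx 2 i (by norm_num) hi
          exact mul_le_mul (by linarith) (by linarith) (hx0 i (by omega)) (by positivity)
      _ = ((N + 1 - 2 : ℕ) : ℝ) * (4 * k * (x 0 - x 1)) := by simp
      _ ≤ N * (4 * k * (x 0 - x 1)) := by
          have h : ((N + 1 - 2 : ℕ) : ℝ) ≤ N := by exact_mod_cast (by omega : N + 1 - 2 ≤ N)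
          exact mul_le_mul_of_nonneg_right h (mul_nonneg (by positivity) (by linarith))
  have hsplit : ∑ i ∈ Finset.Icc 1 N, b i * x i = b 1 * x 1 + ∑ i ∈ Finset.Icc 2 N, b i * x i := by
    rw [← Finset.add_sum_Ioc_eq_sum_Icc hN]
    rfl
  have h1 := mul_nonneg (show 0 ≤ b 0 - k - 4 * k * N by linarith) (show 0 ≤ x 0 - x 1 by linarith)
  have h2 := mul_nonneg (show 0 ≤ b 0 - b 1 by linarith) hx1
  rw [hsplit]
  linarith

/-- A reduced `b` of large degree pairs with every reduced `c₁`-positive `x` at least as much as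
`kH - kE₁` does. -/
lemma pairing_ge {N : ℕ} (hN : 10 ≤ N) {k : ℝ} (hk : 0 ≤ k) {b x : ℕ → ℝ}
    (hb : ∀ i j, 1 ≤ i → i ≤ j → b j ≤ b i) (hb0 : ∀ i, 1 ≤ i → 0 ≤ b i)
    (hbr : b 1 + b 2 + b 3 ≤ b 0) (hba : 9 * k + 4 * k * N ≤ b 0)
    (hbC : 14 * k ≤ 3 * b 0 - ∑ i ∈ Finset.Icc 1 9, b i)
    (hbc : 0 ≤ 3 * b 0 - ∑ i ∈ Finset.Icc 1 N, b i)
    (hx : ∀ i j, 1 ≤ i → i ≤ j → x j ≤ x i) (hx0 : ∀ i, 1 ≤ i → 0 ≤ x i)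
    (hxr : x 1 + x 2 + x 3 ≤ x 0) (hxc : 0 ≤ 3 * x 0 - ∑ i ∈ Finset.Icc 1 N, x i) :
    k * (x 0 - x 1) ≤ b 0 * x 0 - ∑ i ∈ Finset.Icc 1 N, b i * x i := by
  rcases le_total (b 0 - b 1) (4 * k) with hd | hd
  · exact pairing_ge_of_sub_le hk hb hb0 hbr hba hd hx hx0 hxr (by omega)
  have hkN : 0 ≤ 4 * k * N := by positivity
  have htail : ∑ i ∈ Finset.Icc 10 N, b i * x i ≤ (∑ i ∈ Finset.Icc 10 N, b i) * x 10 := by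
    rw [Finset.sum_mul]
    refine Finset.sum_le_sum fun i hi => ?_
    have hi := (Finset.mem_Icc.1 hi).1
    exact mul_le_mul_of_nonneg_left (hx 10 i (by norm_num) hi) (hb0 i (by omega))
  have hx10 : x 10 ≤ ∑ i ∈ Finset.Icc 10 N, x i :=
    Finset.single_le_sum (f := x) (fun i hi => hx0 i (by have := Finset.mem_Icc.1 hi; omega))
      (Finset.mem_Icc.2 ⟨le_rfl, hN⟩)
  rw [sum_Icc_one_split _ hN, sum_Icc_one_nine] at hbc hxc ⊢
  rw [sum_Icc_one_nine] at hbC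
  have key := pairing_ge_of_reduced_nine (x := fun i => x i - if i = 0 then 3 * x 10 else x 10) hk
    hb0 hbr (by linarith) hd hbC
    (fun i hi _ => by
      have := hx i (i + 1) hi (by omega)
      simp only [Nat.add_eq_zero_iff, one_ne_zero, and_false, if_false, if_neg (by omega : i ≠ 0)]
      linarith)
    (by simpa using hx 9 10 (by norm_num) (by norm_num))
    (by norm_num; linarith)
  norm_num at key
  have h1 := mul_nonneg hbc (hx0 10 (by norm_num))
  have h2 := mul_nonneg hk (show 0 ≤ 3 * x 0 - (x 1 + x 2 + x 3 + x 4 + x 5 + x 6 + x 7 + x 8 + x 9)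
    - x 10 by linarith)
  linarith

/-- Enlarging an interval past the support of the summand does not change the sum. -/
lemma sum_Icc_eq_of_support {R : Type*} [AddCommMonoid R] {f : ℕ → R} {m N : ℕ} (hmN : m ≤ N)
    (hf : ∀ i, m < i → i ≤ N → f i = 0) :
    ∑ i ∈ Finset.Icc 1 m, f i = ∑ i ∈ Finset.Icc 1 N, f i := by
  refine Finset.sum_subset (Finset.Icc_subset_Icc_right hmN) fun i hi hi' => ?_
  simp only [Finset.mem_Icc] at hi hi'
  exact hf i (by omega) hi.2

lemma kHkE1_mem_U5 {n k : ℕ} (hn : 1 ≤ n) (hk : 1 ≤ k) : kHkE1 k ∈ U5 n k := by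
  refine ⟨by simp only [kHkE1, if_true]; omega, ?_, fun i hi => ?_⟩
  · have hs : ∑ i ∈ Finset.Icc 1 n, ((kHkE1 k i) ^ 2 + kHkE1 k i) = (k : ℤ) ^ 2 + k := by
      rw [Finset.sum_eq_single_of_mem 1 (Finset.mem_Icc.2 ⟨le_rfl, hn⟩)]
      · simp [kHkE1]
      · intro i hi hi1
        have hi0 : i ≠ 0 := by have := (Finset.mem_Icc.1 hi).1; omega
        simp [kHkE1, hi1, hi0]
    rw [indCl, hs]
    simp only [kHkE1, if_true]
    linarith
  · rw [kHkE1, if_neg (by omega), if_neg (by omega)]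

lemma omegaEval_kHkE1 {n k : ℕ} (hn : 1 ≤ n) (x : ℕ → ℝ) :
    omegaEval n x (kHkE1 k) = k * (x 0 - x 1) := by
  rw [omegaEval, Finset.sum_eq_single_of_mem 1 (Finset.mem_Icc.2 ⟨le_rfl, hn⟩)]
  · simp [kHkE1]
    ring
  · intro i hi hi1
    have hi0 : i ≠ 0 := by have := (Finset.mem_Icc.1 hi).1; omega
    simp [kHkE1, hi1, hi0]

lemma geCl_kHkE1 {n k : ℕ} (hn : 3 ≤ n) {A : ℕ → ℤ} (hsupp : ∀ i, n < i → A i = 0)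
    (hred : ReducedCl n A) (ha : 9 * (k : ℝ) + 4 * k * (n + 10 : ℕ) < (A 0 : ℝ))
    (hC : 14 * (k : ℝ) < ((3 * A 0 - ∑ i ∈ Finset.Icc 1 (min n 9), A i : ℤ) : ℝ))
    (hc : 1 ≤ 3 * A 0 - ∑ i ∈ Finset.Icc 1 n, A i) : geCl n A (kHkE1 k) := by
  rintro x ⟨hxc, hx⟩
  rw [if_neg (by omega), if_neg (by omega)] at hx
  obtain ⟨hxn, hxa, hxr, -⟩ := hx
  obtain ⟨-, hAa, hAn, hAr⟩ := hred
  have hA0 : ∀ i, 1 ≤ i → 0 ≤ A i := fun i hi => by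
    rcases le_or_gt i n with h | h
    · exact hAn.trans (hAa i n hi h le_rfl)
    · exact (hsupp i h).ge
  have hAa' : ∀ i j, 1 ≤ i → i ≤ j → A j ≤ A i := fun i j hi hij => by
    rcases le_or_gt j n with h | h
    · exact hAa i j hi hij h
    · exact (hsupp j h).le.trans (hA0 i hi)
  let y : ℕ → ℝ := fun i => if i ≤ n then x i else 0
  have hy : ∀ i, i ≤ n → y i = x i := fun i h => if_pos h
  have hy' : ∀ i, n < i → y i = 0 := fun i h => if_neg (by omega)
  have hy0 : ∀ i, 1 ≤ i → 0 ≤ y i := fun i hi => by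
    rcases le_or_gt i n with h | h
    · exact (hxn.le.trans (hxa i n hi h le_rfl)).trans (hy i h).ge
    · exact (hy' i h).ge
  have hya : ∀ i j, 1 ≤ i → i ≤ j → y j ≤ y i := fun i j hi hij => by
    rcases le_or_gt j n with h | h
    · rw [hy j h, hy i (hij.trans h)]
      exact hxa i j hi hij h
    · exact (hy' j h).le.trans (hy0 i hi)
  have hsumx : ∑ i ∈ Finset.Icc 1 n, x i = ∑ i ∈ Finset.Icc 1 (n + 10), y i := by
    rw [← sum_Icc_eq_of_support (by omega : n ≤ n + 10) fun i hi _ => hy' i hi]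
    exact Finset.sum_congr rfl fun i hi => (hy i (Finset.mem_Icc.1 hi).2).symm
  have hsumAx : ∑ i ∈ Finset.Icc 1 n, (A i : ℝ) * x i
      = ∑ i ∈ Finset.Icc 1 (n + 10), (A i : ℝ) * y i := by
    rw [← sum_Icc_eq_of_support (by omega : n ≤ n + 10) fun i hi _ => by simp [hy' i hi]]
    exact Finset.sum_congr rfl fun i hi => by rw [hy i (Finset.mem_Icc.1 hi).2]
  rw [sum_Icc_eq_of_support (min_le_right n 9) fun i hi h => hsupp i (by omega)] at hC
  rw [sum_Icc_eq_of_support (by omega : n ≤ n + 10) fun i hi _ => hsupp i hi] at hc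
  have hc' : (1 : ℝ) ≤ 3 * (A 0 : ℝ) - ∑ i ∈ Finset.Icc 1 (n + 10), (A i : ℝ) := by
    exact_mod_cast hc
  push_cast at hC
  rw [omegaEval_kHkE1 (by omega), omegaEval, hsumAx, ← hy 0 (by omega), ← hy 1 (by omega)]
  refine pairing_ge (b := fun i => (A i : ℝ)) (by omega) k.cast_nonneg
    (fun i j hi hij => Int.cast_le.2 (hAa' i j hi hij)) (fun i hi => Int.cast_nonneg (hA0 i hi))
    (by exact_mod_cast hAr) ha.le hC.le (by linarith) hya hy0 ?_ ?_
  · rwa [hy 0 (by omega), hy 1 (by omega), hy 2 (by omega), hy 3 (by omega)]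
  · rw [← hsumx, hy 0 (by omega)]
    exact hxc.le

/-- There are constants `A_{n,k}`, `C_{n,k}` such that every reduced class
`A = aH - ∑ b_i E_i ∈ U_5^{(k)}` with `a > A_{n,k}`,
`3a - ∑_{i ≤ min(n,9)} b_i > C_{n,k}` and `3a - ∑ b_i ≥ 1` satisfies
`A ≥ kH - kE_1`; in particular `A` is not minimal. -/
theorem large_classes_dominated (n k : ℕ) (hn : 3 ≤ n) (hk : 1 ≤ k) :
    ∃ Ank Cnk : ℝ, ∀ A ∈ U5 n k, ReducedCl n A →
      Ank < (A 0 : ℝ) →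
      Cnk < ((3 * A 0 - ∑ i ∈ Finset.Icc 1 (min n 9), A i : ℤ) : ℝ) →
      1 ≤ 3 * A 0 - ∑ i ∈ Finset.Icc 1 n, A i →
      geCl n A (kHkE1 k) ∧ ¬ MinimalU5 n k A := by
  refine ⟨9 * (k : ℝ) + 4 * k * (n + 10 : ℕ), 14 * (k : ℝ), fun A hA hred ha hC hc => ?_⟩
  have hge := geCl_kHkE1 hn hA.2.2 hred ha hC hc
  refine ⟨hge, fun hmin => hmin.2 _ (kHkE1_mem_U5 (by omega) hk) ?_ hge⟩
  rintro rfl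
  have hk0 : (0 : ℝ) ≤ 8 * k + 4 * k * (n + 10 : ℕ) := by positivity
  simp only [kHkE1, if_true, Int.cast_natCast] at ha
  linarith
end

section
/- Let n = 10 and for each integer a ≥ 1 set N_a = 3H − E_1 − ... − E_8 + ((a^2 + a)/2)(3H − E_1 − ... − E_9) − a E_{10}, a class in Z^{11}. Then: (i) ind(N_a) = 2 for every a ≥ 1; (ii) for every a ≥ 1 there exists ε_0 > 0 such that for all 0 < ε < ε_0, the point x = (1, (1−ε)/3, (1−ε)/3, ..., (1−ε)/3, (3a+4)ε) ∈ R^{11} (with nine coordinates equal to (1−ε)/3) lies in the reduced cone P, and ω_x(N_{a+1}) < ω_x(N_j) for every 1 ≤ j ≤ a. -/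
/-- The reduced cone `P` for `n = 10`. -/
def reducedCone10 : Set (ℕ → ℝ) :=
  {x | 0 < x 10 ∧ (∀ i j, 1 ≤ i → i ≤ j → j ≤ 10 → x j ≤ x i) ∧
    x 1 + x 2 + x 3 ≤ x 0 ∧ ∑ i ∈ Finset.Icc 1 10, (x i) ^ 2 < (x 0) ^ 2}

/-- The class `N_a = 3H - E_1 - ⋯ - E_8 + ((a²+a)/2)(3H - E_1 - ⋯ - E_9) - a E_{10}`
in `ℤ^{11}` (note `(a²+a)/2` is an integer). -/
def Ncl (a : ℤ) : ℕ → ℤ := fun i =>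
  if i = 0 then 3 + 3 * ((a ^ 2 + a) / 2)
  else if i ≤ 8 then 1 + (a ^ 2 + a) / 2
  else if i = 9 then (a ^ 2 + a) / 2
  else if i = 10 then a
  else 0

/-- The point `x = (1, (1-ε)/3, …, (1-ε)/3, (3a+4)ε)` with nine coordinates
equal to `(1-ε)/3`. -/
noncomputable def xPt (a : ℤ) (ε : ℝ) : ℕ → ℝ := fun i =>
  if i = 0 then 1
  else if i ≤ 9 then (1 - ε) / 3
  else if i = 10 then (3 * (a : ℝ) + 4) * ε
  else 0

/-- The integer division in `(a² + a) / 2` is exact. -/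
theorem two_mul_sq_add_self_ediv_two (a : ℤ) : 2 * ((a ^ 2 + a) / 2) = a ^ 2 + a :=
  Int.mul_ediv_cancel' (by
    simpa only [sq, mul_add_one] using (Int.even_mul_succ_self a).two_dvd)

/-- Every class `N_a` has index `2`. -/
theorem indCl_Ncl (a : ℤ) : indCl 10 (Ncl a) = 2 := by
  have h := two_mul_sq_add_self_ediv_two a
  simp only [indCl, Ncl, Finset.sum_Icc_succ_top, Nat.reduceLeDiff, Nat.reduceAdd, Finset.Icc_self,
    Finset.sum_singleton]
  norm_num
  linear_combination h

/-- The pairing of `xPt a ε` with `N_b` is a quadratic polynomial in `b`. -/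
theorem omegaEval_xPt_Ncl (a b : ℤ) (ε : ℝ) :
    omegaEval 10 (xPt a ε) (Ncl b) =
      (1 + 8 * ε) / 3 + ε * (3 * ((b : ℝ) ^ 2 + b) / 2 - b * (3 * a + 4)) := by
  have h := two_mul_sq_add_self_ediv_two b
  have h' : 2 * (((b ^ 2 + b) / 2 : ℤ) : ℝ) = (b : ℝ) ^ 2 + b := by exact_mod_cast h
  simp only [omegaEval, Ncl, xPt]
  generalize (b ^ 2 + b) / 2 = t at h'
  norm_num [Finset.sum_Icc_succ_top]
  linear_combination (3 * ε / 2) * h'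

/-- For small `ε > 0` the point `xPt a ε` lies in the reduced cone. -/
theorem xPt_mem_reducedCone10 {a : ℤ} {ε : ℝ} (ha : (1 : ℝ) ≤ a) (hε : 0 < ε)
    (hlt : ε * (1 + (3 * (a : ℝ) + 4) ^ 2) < 1) : xPt a ε ∈ reducedCone10 := by
  have hle : (3 * (a : ℝ) + 4) * ε ≤ (1 - ε) / 3 := by
    have : 0 ≤ ε * (9 * (a : ℝ) ^ 2 + 15 * a + 4) := by positivity
    linarith
  refine ⟨?_, fun i j hi hij hj => ?_, ?_, ?_⟩
  · norm_num [xPt]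
    positivity
  · have hi0 : i ≠ 0 := by omega
    have hj0 : j ≠ 0 := by omega
    simp only [xPt, hi0, hj0, if_false]
    split_ifs <;> first | omega | linarith
  · norm_num [xPt]
    linarith
  · norm_num [xPt, Finset.sum_Icc_succ_top]
    nlinarith [mul_lt_mul_of_pos_left hlt hε]

/-- (i) `ind(N_a) = 2` for every `a ≥ 1`; (ii) for each `a ≥ 1` and all small
enough `ε > 0`, the point `xPt a ε` lies in the reduced cone `P` and
`ω_x(N_{a+1}) < ω_x(N_j)` for every `1 ≤ j ≤ a`. -/
theorem no_tropical_outside_c1nef :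
    (∀ a : ℤ, 1 ≤ a → indCl 10 (Ncl a) = 2) ∧
    (∀ a : ℤ, 1 ≤ a → ∃ ε₀ : ℝ, 0 < ε₀ ∧ ∀ ε : ℝ, 0 < ε → ε < ε₀ →
      xPt a ε ∈ reducedCone10 ∧
      ∀ j : ℤ, 1 ≤ j → j ≤ a →
        omegaEval 10 (xPt a ε) (Ncl (a + 1)) < omegaEval 10 (xPt a ε) (Ncl j)) := by
  refine ⟨fun a _ => indCl_Ncl a, fun a ha => ?_⟩
  have ha' : (1 : ℝ) ≤ a := by exact_mod_cast ha
  refine ⟨1 / (1 + (3 * (a : ℝ) + 4) ^ 2), by positivity, fun ε hε hlt => ?_⟩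
  rw [lt_div_iff₀ (by positivity)] at hlt
  refine ⟨xPt_mem_reducedCone10 ha' hε hlt, fun j _ hj => ?_⟩
  rw [omegaEval_xPt_Ncl, omegaEval_xPt_Ncl]
  have hj' : (j : ℝ) ≤ a := by exact_mod_cast hj
  have key : 0 < ε * (((a : ℝ) + 1 - j) * (3 * a + 2 - 3 * j)) :=
    mul_pos hε (mul_pos (by linarith) (by linarith))
  push_cast
  linarith
end

section
/- Fix an integer k ≥ 0, a positive real c, and positive reals a_1, ..., a_p and b_1, ..., b_q (p, q ≥ 0). Then the infimum, over all tuples (k_1, ..., k_p, m_1, ..., m_q) of nonnegative integers, of ν(k + Σ_i k_i + Σ_j m_j)·c − Σ_i ν(k_i)·a_i − Σ_j ν(m_j)·b_j equals the infimum, over all tuples (x, y_1, ..., y_p, z_1, ..., z_q) of nonnegative integers satisfying x(x+3) − Σ_i y_i(y_i+1) − Σ_j z_j(z_j+1) ≥ 2k, of x·c − Σ_i y_i·a_i − Σ_j z_j·b_j (both infima taken in R ∪ {−∞}). -/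
/-- For a nonnegative integer `K`, `nu K` is the unique nonnegative integer `d`
with `d(d+1) ≤ 2K ≤ d(d+3)`; `nu K · c` is the `K`-th ECH capacity of the ball
`B(c)`. -/
noncomputable def nu (K : ℕ) : ℕ :=
  sInf {d : ℕ | d * (d + 1) ≤ 2 * K ∧ 2 * K ≤ d * (d + 3)}

theorem exists_mul_succ_le_two_mul (K : ℕ) :
    ∃ d : ℕ, d * (d + 1) ≤ 2 * K ∧ 2 * K ≤ d * (d + 3) := by
  induction K with
  | zero => exact ⟨0, by simp⟩
  | succ K ih =>
    obtain ⟨d, h₁, h₂⟩ := ih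
    obtain ⟨r, hr⟩ := Nat.even_mul_succ_self d
    by_cases h : 2 * (K + 1) ≤ d * (d + 3)
    · exact ⟨d, by omega, h⟩
    · refine ⟨d + 1, ?_, ?_⟩
      · have : d * (d + 3) = d * (d + 1) + 2 * d := by ring
        have : (d + 1) * (d + 1 + 1) = d * (d + 1) + 2 * d + 2 := by ring
        omega
      · nlinarith

theorem nu_spec (K : ℕ) : nu K * (nu K + 1) ≤ 2 * K ∧ 2 * K ≤ nu K * (nu K + 3) :=
  Nat.sInf_mem (s := {d : ℕ | d * (d + 1) ≤ 2 * K ∧ 2 * K ≤ d * (d + 3)})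
    (exists_mul_succ_le_two_mul K)

theorem nu_le_of_two_mul_le {K x : ℕ} (h : 2 * K ≤ x * (x + 3)) : nu K ≤ x := by
  by_contra! hx
  nlinarith [(nu_spec K).1]

theorem le_nu_of_mul_succ_le {K x : ℕ} (h : x * (x + 1) ≤ 2 * K) : x ≤ nu K := by
  by_contra! hx
  nlinarith [(nu_spec K).2]

theorem two_mul_triangle (y : ℕ) : 2 * (y * (y + 1) / 2) = y * (y + 1) :=
  Nat.two_mul_div_two_of_even (Nat.even_mul_succ_self y)

theorem nu_triangle (y : ℕ) : nu (y * (y + 1) / 2) = y := by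
  have h := two_mul_triangle y
  exact le_antisymm (nu_le_of_two_mul_le (by nlinarith)) (le_nu_of_mul_succ_le h.ge)

theorem sum_nu_mul_succ_le {ι : Type*} [Fintype ι] (K : ι → ℕ) :
    ∑ i, (nu (K i) : ℤ) * (nu (K i) + 1) ≤ 2 * ∑ i, (K i : ℤ) := by
  rw [Finset.mul_sum]
  exact Finset.sum_le_sum fun i _ => mod_cast (nu_spec (K i)).1

theorem two_mul_sum_triangle {ι : Type*} [Fintype ι] (y : ι → ℕ) :
    2 * ∑ i, ((y i * (y i + 1) / 2 : ℕ) : ℤ) = ∑ i, (y i : ℤ) * (y i + 1) := by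
  rw [Finset.mul_sum]
  exact Finset.sum_congr rfl fun i _ => mod_cast two_mul_triangle (y i)

/-- The combinatorial content of the weight-sequence formula for ECH capacities
of convex toric domains: the infimum over subdivisions of the ball capacities
equals the infimum over the index-constrained lattice optimization problem
(both infima taken in `ℝ ∪ {-∞}`, i.e. in `EReal`). -/
theorem ech_weight_formula (k : ℕ) (c : ℝ) (hc : 0 < c) (p q : ℕ)
    (a : Fin p → ℝ) (b : Fin q → ℝ) (ha : ∀ i, 0 < a i) (hb : ∀ j, 0 < b j) :
    sInf {v : EReal | ∃ K : Fin p → ℕ, ∃ M : Fin q → ℕ,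
        v = (((nu (k + ∑ i, K i + ∑ j, M j) : ℝ) * c
          - ∑ i, (nu (K i) : ℝ) * a i - ∑ j, (nu (M j) : ℝ) * b j : ℝ) : EReal)} =
    sInf {v : EReal | ∃ x : ℕ, ∃ y : Fin p → ℕ, ∃ z : Fin q → ℕ,
        2 * (k : ℤ) ≤ (x : ℤ) * (x + 3) - ∑ i, (y i : ℤ) * (y i + 1)
          - ∑ j, (z j : ℤ) * (z j + 1) ∧
        v = (((x : ℝ) * c - ∑ i, (y i : ℝ) * a i - ∑ j, (z j : ℝ) * b j : ℝ) : EReal)} := by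
  apply le_antisymm
  · refine le_sInf ?_
    rintro _ ⟨x, y, z, h, rfl⟩
    refine le_trans (sInf_le ⟨fun i => y i * (y i + 1) / 2, fun j => z j * (z j + 1) / 2, rfl⟩) ?_
    simp only [nu_triangle, EReal.coe_le_coe_iff]
    have hx : nu (k + ∑ i, y i * (y i + 1) / 2 + ∑ j, z j * (z j + 1) / 2) ≤ x := by
      apply nu_le_of_two_mul_le
      have hy := two_mul_sum_triangle y
      have hz := two_mul_sum_triangle z
      zify at hy hz ⊢
      linarith
    gcongr
  · refine sInf_le_sInf ?_
    rintro _ ⟨K, M, rfl⟩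
    refine ⟨_, fun i => nu (K i), fun j => nu (M j), ?_, rfl⟩
    have h := (nu_spec (k + ∑ i, K i + ∑ j, M j)).2
    zify at h
    linarith [sum_nu_mul_succ_le K, sum_nu_mul_succ_le M]
end

section
/- For all x ∈ (0,1), f_2(x) = min(2 − 2x, 1). -/
/-- The `k`-th tamed capacity of `CP² # CP²-bar` with symplectic class `(1, x)`:
`f_k(x) = inf { a - b·x : a, b ∈ ℤ, a ≥ 1, a² + 3a - b² - b ≥ 2k }`. -/
noncomputable def f (k : ℕ) (x : ℝ) : ℝ :=
  sInf {v : ℝ | ∃ a b : ℤ, 1 ≤ a ∧ 2 * (k : ℤ) ≤ a ^ 2 + 3 * a - b ^ 2 - b ∧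
    v = (a : ℝ) - (b : ℝ) * x}

theorem capacity_formula_f2 (x : ℝ) (hx0 : 0 < x) (hx1 : x < 1) :
    f 2 x = min (2 - 2 * x) 1 := by
  refine IsLeast.csInf_eq ⟨?_, ?_⟩
  · rcases min_choice (2 - 2 * x) 1 with h | h <;> rw [h]
    · exact ⟨2, 2, by norm_num, by norm_num, by norm_num⟩
    · exact ⟨1, 0, by norm_num, by norm_num, by norm_num⟩
  · rintro v ⟨a, b, ha, hab, rfl⟩
    push_cast at hab
    rcases ha.eq_or_lt with rfl | ha
    · have hb : b ≤ 0 := by nlinarith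
      have hb' : (b : ℝ) ≤ 0 := by exact_mod_cast hb
      refine (min_le_right _ _).trans ?_
      push_cast
      nlinarith
    · have hb : b ≤ a := by
        by_contra! h
        nlinarith
      have hb' : (b : ℝ) ≤ a := by exact_mod_cast hb
      have ha' : (2 : ℝ) ≤ a := by exact_mod_cast ha
      refine (min_le_left _ _).trans ?_
      nlinarith
end

section
/- For all x ∈ (0,1), f_3(x) = min(3 − 3x, 2 − x). -/
/-- A class `aH - bE` with `a ≥ 1` and index at least `6` has area at least
that of `3H - 3E` or that of `2H - E`. -/
theorem min_le_area_of_six_le_index {x : ℝ} (hx0 : 0 < x) (hx1 : x < 1) {a b : ℤ} (ha : 1 ≤ a)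
    (hab : 6 ≤ a ^ 2 + 3 * a - b ^ 2 - b) :
    min (3 - 3 * x) (2 - x) ≤ (a : ℝ) - (b : ℝ) * x := by
  have hba : b ≤ a := by
    by_contra! h
    nlinarith
  rcases hba.eq_or_lt with rfl | hlt
  · have hb : (3 : ℝ) ≤ b := by exact_mod_cast (by nlinarith : 3 ≤ b)
    exact (min_le_left _ _).trans (by nlinarith)
  · have h2 : 2 ≤ a := by
      by_contra! h
      obtain rfl : a = 1 := by omega
      rcases le_or_gt 0 b with h0 | h0 <;> nlinarith
    have h2' : (2 : ℝ) ≤ a := by exact_mod_cast h2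
    have hb : (b : ℝ) ≤ a - 1 := by exact_mod_cast (by omega : b ≤ a - 1)
    refine (min_le_right _ _).trans ?_
    nlinarith [mul_nonneg (sub_nonneg.2 h2') (sub_nonneg.2 hx1.le),
      mul_nonneg (sub_nonneg.2 hb) hx0.le]

theorem capacity_formula_f3 (x : ℝ) (hx0 : 0 < x) (hx1 : x < 1) :
    f 3 x = min (3 - 3 * x) (2 - x) := by
  refine IsLeast.csInf_eq ⟨?_, ?_⟩
  · rcases min_choice (3 - 3 * x) (2 - x) with h | h <;> rw [h]
    · exact ⟨3, 3, by norm_num, by norm_num, by norm_num⟩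
    · exact ⟨2, 1, by norm_num, by norm_num, by norm_num⟩
  · rintro v ⟨a, b, ha, hab, rfl⟩
    exact min_le_area_of_six_le_index hx0 hx1 ha (by simpa using hab)
end

section
/- For all x ∈ (0,1), f_4(x) = min(4 − 4x, 2 − x). -/
/-- A class of index at least `8` with `a ≥ 1` has `a ≥ 4` and `b ≤ a`, or `a ≥ 2` and
`b ≤ a - 1`. -/
theorem bounds_of_eight_le_index {a b : ℤ} (ha : 1 ≤ a)
    (h : 8 ≤ a ^ 2 + 3 * a - b ^ 2 - b) :
    (4 ≤ a ∧ b ≤ a) ∨ (2 ≤ a ∧ b ≤ a - 1) := by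
  have hba : b ≤ a := by
    by_contra! hlt
    nlinarith
  by_cases h4 : 4 ≤ a
  · exact Or.inl ⟨h4, hba⟩
  · right
    have ha3 : a ≤ 3 := by omega
    constructor
    · by_contra! hlt
      have : a = 1 := by omega
      subst this
      nlinarith [sq_nonneg (2 * b + 1)]
    · by_contra! hlt
      have : b = a := by omega
      subst this
      nlinarith

theorem capacity_formula_f4 (x : ℝ) (hx0 : 0 < x) (hx1 : x < 1) :
    f 4 x = min (4 - 4 * x) (2 - x) := by
  have hleast : IsLeast {v : ℝ | ∃ a b : ℤ, 1 ≤ a ∧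
      2 * ((4 : ℕ) : ℤ) ≤ a ^ 2 + 3 * a - b ^ 2 - b ∧ v = (a : ℝ) - (b : ℝ) * x}
      (min (4 - 4 * x) (2 - x)) := by
    constructor
    · rcases min_choice (4 - 4 * x) (2 - x) with h | h <;> rw [h]
      · exact ⟨4, 4, by norm_num, by norm_num, by norm_num⟩
      · exact ⟨2, 1, by norm_num, by norm_num, by norm_num⟩
    · rintro v ⟨a, b, ha, h, rfl⟩
      rcases bounds_of_eight_le_index ha (by simpa using h) with ⟨h1, h2⟩ | ⟨h1, h2⟩
      · have h1' : (4 : ℝ) ≤ a := by exact_mod_cast h1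
        have h2' : (b : ℝ) ≤ a := by exact_mod_cast h2
        refine (min_le_left _ _).trans ?_
        nlinarith
      · have h1' : (2 : ℝ) ≤ a := by exact_mod_cast h1
        have h2' : (b : ℝ) ≤ a - 1 := by exact_mod_cast h2
        refine (min_le_right _ _).trans ?_
        nlinarith
  exact hleast.csInf_eq
end

section
/- For all x ∈ (0,1), f_5(x) = min(5 − 5x, 3 − 2x, 2). -/
theorem le_of_index_nonneg {a b : ℤ} (ha : 1 ≤ a) (h : 0 ≤ a ^ 2 + 3 * a - b ^ 2 - b) :
    b ≤ a := by
  by_contra! hab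
  nlinarith

theorem min_le_of_ten_le_index {x : ℝ} (hx0 : 0 < x) (hx1 : x < 1) {a b : ℤ} (ha : 1 ≤ a)
    (h : 10 ≤ a ^ 2 + 3 * a - b ^ 2 - b) :
    min (min (5 - 5 * x) (3 - 2 * x)) 2 ≤ (a : ℝ) - b * x := by
  rcases le_or_gt 5 a with h5 | h5
  · refine (min_le_left _ _).trans ((min_le_left _ _).trans ?_)
    have hba : (b : ℝ) ≤ a := by
      exact_mod_cast le_of_index_nonneg ha (by linarith)
    have h5' : (5 : ℝ) ≤ a := by exact_mod_cast h5
    nlinarith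
  · have hmul {n : ℤ} (hb : b ≤ n) : (b : ℝ) * x ≤ n * x :=
      mul_le_mul_of_nonneg_right (by exact_mod_cast hb) hx0.le
    obtain rfl | rfl | rfl | rfl : a = 1 ∨ a = 2 ∨ a = 3 ∨ a = 4 := by omega
    · nlinarith [sq_nonneg (2 * b + 1)]
    · have hb : b ≤ 0 := by nlinarith
      have := hmul hb
      refine (min_le_right _ _).trans ?_
      push_cast at *
      linarith
    · have hb : b ≤ 2 := by nlinarith
      have := hmul hb
      refine (min_le_left _ _).trans ((min_le_right _ _).trans ?_)
      push_cast at *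
      linarith
    · have hb : b ≤ 3 := by nlinarith
      have := hmul hb
      refine (min_le_left _ _).trans ((min_le_right _ _).trans ?_)
      push_cast at *
      linarith

theorem capacity_formula_f5 (x : ℝ) (hx0 : 0 < x) (hx1 : x < 1) :
    f 5 x = min (min (5 - 5 * x) (3 - 2 * x)) 2 := by
  refine IsLeast.csInf_eq ⟨?_, ?_⟩
  · rcases min_choice (min (5 - 5 * x) (3 - 2 * x)) 2 with h | h <;> rw [h]
    · rcases min_choice (5 - 5 * x) (3 - 2 * x) with h | h <;> rw [h]
      · exact ⟨5, 5, by norm_num, by norm_num, by norm_num⟩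
      · exact ⟨3, 2, by norm_num, by norm_num, by norm_num⟩
    · exact ⟨2, 0, by norm_num, by norm_num, by norm_num⟩
  · rintro v ⟨a, b, ha, hab, rfl⟩
    exact min_le_of_ten_le_index hx0 hx1 ha (by simpa using hab)
end

section
/- For all x ∈ (0,1), f_6(x) = min(6 − 6x, 3 − 2x). -/
theorem capacity_formula_f6 (x : ℝ) (hx0 : 0 < x) (hx1 : x < 1) :
    f 6 x = min (6 - 6 * x) (3 - 2 * x) := by
  refine IsLeast.csInf_eq ⟨?_, ?_⟩
  · rcases min_choice (6 - 6 * x) (3 - 2 * x) with h | h <;> rw [h]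
    · exact ⟨6, 6, by norm_num, by norm_num, by norm_num⟩
    · exact ⟨3, 2, by norm_num, by norm_num, by norm_num⟩
  · rintro v ⟨a, b, ha, hab, rfl⟩
    push_cast at hab
    have hba : b ≤ a := by
      by_contra! h
      nlinarith
    rcases le_or_gt 6 a with h6 | h6
    · refine min_le_of_left_le ?_
      have h6' : (6 : ℝ) ≤ a := by exact_mod_cast h6
      have hba' : (b : ℝ) ≤ a := by exact_mod_cast hba
      nlinarith
    · refine min_le_of_right_le ?_
      have h3 : 3 ≤ a := by
        by_contra! h
        nlinarith [mul_self_nonneg (2 * b + 1)]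
      have hb : b ≤ a - 1 := by
        by_contra! h
        obtain rfl : b = a := by omega
        nlinarith
      have h3' : (3 : ℝ) ≤ a := by exact_mod_cast h3
      have hb' : (b : ℝ) ≤ a - 1 := by exact_mod_cast hb
      nlinarith
end

section
/- For all x ∈ (0,1), f_7(x) = min(7 − 7x, 4 − 3x, 3 − x). -/
/-- A class whose index is at least `14` is either of degree at least `7`, with `b ≤ a`, or
satisfies one of the bounds on `b` imposed by a small degree. -/
lemma degree_cases_of_index_ge {a b : ℤ} (ha : 1 ≤ a)
    (h : 14 ≤ a ^ 2 + 3 * a - b ^ 2 - b) :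
    (7 ≤ a ∧ b ≤ a) ∨ (4 ≤ a ∧ b ≤ a - 1) ∨ (a = 3 ∧ b ≤ 1) := by
  by_cases h7 : 7 ≤ a
  · left
    refine ⟨h7, ?_⟩
    by_contra! hb
    nlinarith
  · right
    have hb0 : 0 ≤ b ^ 2 + b := by
      rcases le_or_gt 0 b with hb | hb <;> nlinarith
    push Not at h7
    interval_cases a
    · omega
    · omega
    · right
      refine ⟨rfl, ?_⟩
      by_contra! hb
      nlinarith
    all_goals
      left
      refine ⟨by norm_num, ?_⟩
      by_contra! hb
      nlinarith

theorem capacity_formula_f7 (x : ℝ) (hx0 : 0 < x) (hx1 : x < 1) :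
    f 7 x = min (min (7 - 7 * x) (4 - 3 * x)) (3 - x) := by
  refine IsLeast.csInf_eq ⟨?_, ?_⟩
  · rcases min_choice (min (7 - 7 * x) (4 - 3 * x)) (3 - x) with h | h <;> rw [h]
    · rcases min_choice (7 - 7 * x) (4 - 3 * x) with h | h <;> rw [h]
      · exact ⟨7, 7, by norm_num, by norm_num, by norm_num⟩
      · exact ⟨4, 3, by norm_num, by norm_num, by norm_num⟩
    · exact ⟨3, 1, by norm_num, by norm_num, by norm_num⟩
  · rintro v ⟨a, b, ha, hab, rfl⟩
    rcases degree_cases_of_index_ge ha (by simpa using hab) with ⟨h, hb⟩ | ⟨h, hb⟩ | ⟨rfl, hb⟩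
    · refine (min_le_left _ _).trans ((min_le_left _ _).trans ?_)
      have h' : (7 : ℝ) ≤ a := by exact_mod_cast h
      have hb' : (b : ℝ) ≤ a := by exact_mod_cast hb
      nlinarith
    · refine (min_le_left _ _).trans ((min_le_right _ _).trans ?_)
      have h' : (4 : ℝ) ≤ a := by exact_mod_cast h
      have hb' : (b : ℝ) ≤ a - 1 := by exact_mod_cast hb
      nlinarith
    · refine (min_le_right _ _).trans ?_
      have hb' : (b : ℝ) ≤ 1 := by exact_mod_cast hb
      push_cast
      nlinarith
end

section
/- For all x ∈ (0,1), f_8(x) = min(8 − 8x, 4 − 3x, 3 − x). -/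
/-- A class `aH - bE` with `a ≥ 1` and index at least `16` has `a ≥ 3`, and `b` is bounded
according to the size of `a`. -/
theorem admissible_class_cases {a b : ℤ} (ha : 1 ≤ a)
    (h : 16 ≤ a ^ 2 + 3 * a - b ^ 2 - b) :
    (8 ≤ a ∧ b ≤ a) ∨ (4 ≤ a ∧ b ≤ a - 1) ∨ (a = 3 ∧ b ≤ 1) := by
  rcases le_or_gt 8 a with h8 | h8
  · refine Or.inl ⟨h8, ?_⟩
    by_contra! hb
    nlinarith
  · have hb : b ≤ a - 1 := by
      by_contra! hb
      nlinarith
    rcases le_or_gt 4 a with h4 | h4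
    · exact Or.inr (Or.inl ⟨h4, hb⟩)
    · have h3 : a = 3 := by
        by_contra hne
        have ha2 : a ≤ 2 := by omega
        nlinarith [sq_nonneg (2 * b + 1)]
      subst h3
      refine Or.inr (Or.inr ⟨rfl, ?_⟩)
      by_contra! hb1
      nlinarith

theorem capacity_formula_f8 (x : ℝ) (hx0 : 0 < x) (hx1 : x < 1) :
    f 8 x = min (min (8 - 8 * x) (4 - 3 * x)) (3 - x) := by
  have hleast : IsLeast {v : ℝ | ∃ a b : ℤ, 1 ≤ a ∧
      2 * ((8 : ℕ) : ℤ) ≤ a ^ 2 + 3 * a - b ^ 2 - b ∧ v = (a : ℝ) - (b : ℝ) * x}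
      (min (min (8 - 8 * x) (4 - 3 * x)) (3 - x)) := by
    constructor
    · rcases min_choice (min (8 - 8 * x) (4 - 3 * x)) (3 - x) with h | h
      · rw [h]
        rcases min_choice (8 - 8 * x) (4 - 3 * x) with h | h
        · rw [h]
          exact ⟨8, 8, by norm_num, by norm_num, by norm_num⟩
        · rw [h]
          exact ⟨4, 3, by norm_num, by norm_num, by norm_num⟩
      · rw [h]
        exact ⟨3, 1, by norm_num, by norm_num, by norm_num⟩
    · rintro v ⟨a, b, ha, h, rfl⟩
      rw [min_le_iff, min_le_iff]
      rcases admissible_class_cases ha (by simpa using h) with ⟨h8, hb⟩ | ⟨h4, hb⟩ | ⟨rfl, hb⟩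
      · have h8' : (8 : ℝ) ≤ a := by exact_mod_cast h8
        have hb' : (b : ℝ) ≤ a := by exact_mod_cast hb
        left; left
        nlinarith
      · have h4' : (4 : ℝ) ≤ a := by exact_mod_cast h4
        have hb' : (b : ℝ) ≤ a - 1 := by exact_mod_cast hb
        left; right
        nlinarith
      · have hb' : (b : ℝ) ≤ 1 := by exact_mod_cast hb
        right
        push_cast
        nlinarith
  exact hleast.csInf_eq
end
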